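/- arXiv:solv-int/9701005 — 2 statements merged into one kernel-verified Lean document; each statement's English description precedes it below -/
import Mathlib

section
/- In the odd Wronskian setup with n = 2k+1, suppose the superfields a₀, …, a_{2k} solve the kernel system, and that det DW̃^{(1)}, det DW̌^{(1)}, det(W^{(0)} − W^{(1)}(DW̃^{(1)})⁻¹DW̃^{(0)}) and det(W^{(0)} − W^{(1)}(DW̌^{(1)})⁻¹DW̌^{(0)}) are invertible even superfields. Then a_{2k−1} = − (sdet 𝒲)·(sdet 𝒲̌)⁻¹, and a_{2k} = − det(Ŵ^{(0)} − Ŵ^{(1)}(DW̃^{(1)})⁻¹DW̃^{(0)}) · (det(W^{(0)} − W^{(1)}(DW̃^{(1)})⁻¹DW̃^{(0)}))⁻¹, where Ŵ^{(i)} is the matrix W^{(i)} with its last row ∂^k θ^{(i)} replaced by D∂^k θ^{(i)}, and the determinant in the numerator of the a_{2k} formula is of a matrix whose last row consists of odd superfields and all other rows of even superfields, defined by Laplace expansion along that last row. -/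
noncomputable section
open scoped BigOperators

/-- The exterior algebra `Λ` of `ℝ^N`. -/
abbrev SuperAlg (N : ℕ) : Type := ExteriorAlgebra ℝ (Fin N → ℝ)

/-- The even part `Λ₀` of the exterior algebra. -/
def LambdaEven (N : ℕ) : Submodule ℝ (SuperAlg N) :=
  CliffordAlgebra.evenOdd (0 : QuadraticForm ℝ (Fin N → ℝ)) 0

/-- The odd part `Λ₁` of the exterior algebra. -/
def LambdaOdd (N : ℕ) : Submodule ℝ (SuperAlg N) :=
  CliffordAlgebra.evenOdd (0 : QuadraticForm ℝ (Fin N → ℝ)) 1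

/-- A superfield: a pair `(f₀, f₁)` of maps `ℝ² → Λ`, encoding
`f(x,t,ϑ) = f₀(x,t) + ϑ f₁(x,t)`. -/
@[ext] structure SF (N : ℕ) where
  c0 : ℝ → ℝ → SuperAlg N
  c1 : ℝ → ℝ → SuperAlg N

namespace SF
variable {N : ℕ}

instance : Zero (SF N) := ⟨⟨0, 0⟩⟩
instance : Add (SF N) := ⟨fun f g => ⟨f.c0 + g.c0, f.c1 + g.c1⟩⟩
instance : Neg (SF N) := ⟨fun f => ⟨-f.c0, -f.c1⟩⟩
instance : Sub (SF N) := ⟨fun f g => ⟨f.c0 - g.c0, f.c1 - g.c1⟩⟩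
instance : SMul ℕ (SF N) := ⟨fun n f => ⟨n • f.c0, n • f.c1⟩⟩
instance : SMul ℤ (SF N) := ⟨fun n f => ⟨n • f.c0, n • f.c1⟩⟩
instance : SMul ℝ (SF N) := ⟨fun r f => ⟨r • f.c0, r • f.c1⟩⟩

instance : AddCommGroup (SF N) :=
  Function.Injective.addCommGroup
    (M₂ := (ℝ → ℝ → SuperAlg N) × (ℝ → ℝ → SuperAlg N))
    (fun f => (f.c0, f.c1))
    (fun a b h => by cases a; cases b; simpa using h)
    rfl (fun _ _ => rfl) (fun _ => rfl) (fun _ _ => rfl) (fun _ _ => rfl) (fun _ _ => rfl)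

instance : One (SF N) := ⟨⟨fun _ _ => 1, fun _ _ => 0⟩⟩

/-- The product of superfields: `(fg)₀ = f₀g₀`,
`(fg)₁ = f₁g₀ + σ(f₀)g₁` where `σ` is the grade involution of `Λ`
(this is the bilinear extension of the parity-sign formula for homogeneous factors). -/
instance : Mul (SF N) := ⟨fun f g =>
  ⟨fun x t => f.c0 x t * g.c0 x t,
   fun x t => f.c1 x t * g.c0 x t + CliffordAlgebra.involute (f.c0 x t) * g.c1 x t⟩⟩

/-- An even superfield. -/
def IsEven (f : SF N) : Prop :=
  (∀ x t, f.c0 x t ∈ LambdaEven N) ∧ (∀ x t, f.c1 x t ∈ LambdaOdd N)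

/-- An odd superfield. -/
def IsOdd (f : SF N) : Prop :=
  (∀ x t, f.c0 x t ∈ LambdaOdd N) ∧ (∀ x t, f.c1 x t ∈ LambdaEven N)

/-- A superfield is invertible when `f₀(x,t)` is invertible in `Λ` for all `(x,t)`. -/
def Invertible (f : SF N) : Prop := ∀ x t, IsUnit (f.c0 x t)

/-- The multiplicative inverse of a superfield (junk unless `f` is invertible). -/
def sinv (f : SF N) : SF N :=
  ⟨fun x t => Ring.inverse (f.c0 x t),
   fun x t => -(Ring.inverse (CliffordAlgebra.involute (f.c0 x t)) * f.c1 x t *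
      Ring.inverse (f.c0 x t))⟩

end SF

/-- Derivative of a `Λ`-valued function of one real variable, characterized through all
linear functionals (junk value `0` when not differentiable). -/
def derLam {N : ℕ} (g : ℝ → SuperAlg N) (x : ℝ) : SuperAlg N := by
  classical
  exact if h : ∃ d : SuperAlg N, ∀ l : SuperAlg N →ₗ[ℝ] ℝ,
      HasDerivAt (fun y => l (g y)) (l d) x
    then h.choose else 0

/-- Smoothness of a `Λ`-valued function on `ℝ²`. -/
def SmoothLam {N : ℕ} (g : ℝ → ℝ → SuperAlg N) : Prop :=
  ∀ l : SuperAlg N →ₗ[ℝ] ℝ, ContDiff ℝ (⊤ : ℕ∞) (fun p : ℝ × ℝ => l (g p.1 p.2))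

namespace SF
variable {N : ℕ}

/-- A superfield is smooth when both components are. -/
def Smooth (f : SF N) : Prop := SmoothLam f.c0 ∧ SmoothLam f.c1

/-- `∂f`, the `x`-derivative. -/
def dx (f : SF N) : SF N :=
  ⟨fun x t => derLam (fun y => f.c0 y t) x, fun x t => derLam (fun y => f.c1 y t) x⟩

/-- `∂ₜf`, the `t`-derivative. -/
def dt (f : SF N) : SF N :=
  ⟨fun x t => derLam (fun s => f.c0 x s) t, fun x t => derLam (fun s => f.c1 x s) t⟩

/-- The odd superderivative `D`, with `Df = (f₁, ∂ₓf₀)`, so `D ∘ D = ∂`. -/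
def Dsd (f : SF N) : SF N := ⟨f.c1, fun x t => derLam (fun y => f.c0 y t) x⟩

end SF

/-- `D^n`. -/
def Dpow {N : ℕ} : ℕ → SF N → SF N
  | 0, f => f
  | m + 1, f => (Dpow m f).Dsd

/-- `∂^n`. -/
def Xpow {N : ℕ} : ℕ → SF N → SF N
  | 0, f => f
  | m + 1, f => (Xpow m f).dx

/-- `f` has the parity `(−1)^m`. -/
def parityAt {N : ℕ} (f : SF N) (m : ℕ) : Prop :=
  if m % 2 = 0 then f.IsEven else f.IsOdd

/-- The Manin–Radul supersymmetric KdV system. -/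
def MRSKdV {N : ℕ} (α u : SF N) : Prop :=
  α.dt = (1/4 : ℝ) • (α.dx.dx + (3:ℝ) • (α * α.Dsd) + (6:ℝ) • (α * u)).dx ∧
  u.dt = (1/4 : ℝ) • (u.dx.dx + (3:ℝ) • (u * u) + (3:ℝ) • (α * u.Dsd)).dx

/-- The Lax operator `L = ∂² + αD + u`. -/
def Lop {N : ℕ} (α u ψ : SF N) : SF N := ψ.dx.dx + α * ψ.Dsd + u * ψ

/-- The operator `M = (1/2)α∂D + λ∂ + (1/2)u∂ − (1/4)(∂α)D − (1/4)(∂u)`. -/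
def Mop {N : ℕ} (α u : SF N) (lam : ℝ) (ψ : SF N) : SF N :=
  (1/2 : ℝ) • (α * ψ.Dsd.dx) + lam • ψ.dx + (1/2 : ℝ) • (u * ψ.dx)
    - (1/4 : ℝ) • (α.dx * ψ.Dsd) - (1/4 : ℝ) • (u.dx * ψ)

/-- The linear system `Lψ = λψ`, `∂ₜψ = Mψ` associated with `(α,u)` at `λ`. -/
def LinSys {N : ℕ} (α u : SF N) (lam : ℝ) (ψ : SF N) : Prop :=
  Lop α u ψ = lam • ψ ∧ ψ.dt = Mop α u lam ψ

/-- `δ₀ = −(Dθ₀)θ₀⁻¹`. -/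
def delta0 {N : ℕ} (θ : SF N) : SF N := -(θ.Dsd * θ.sinv)

/-- The Darboux-transformed `α̂ = −α − 2∂δ₀`. -/
def hatAlpha {N : ℕ} (α θ : SF N) : SF N := -α - (2:ℝ) • (delta0 θ).dx

/-- The Darboux-transformed `û = u + Dα + 2δ₀(α + ∂δ₀)`. -/
def hatU {N : ℕ} (α u θ : SF N) : SF N :=
  u + α.Dsd + (2:ℝ) • (delta0 θ * (α + (delta0 θ).dx))

/-- `darbIter θ m j = θ_j[m]`, the `j`-th seed after `m` Darboux steps. -/
def darbIter {N : ℕ} (θ : ℕ → SF N) : ℕ → ℕ → SF N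
  | 0, j => θ j
  | m + 1, j => (darbIter θ m j).Dsd + delta0 (darbIter θ m m) * darbIter θ m j

/-- `Titer θ n ψ = T_n ψ = (D+δ_{n−1})⋯(D+δ₀)ψ`. -/
def Titer {N : ℕ} (θ : ℕ → SF N) : ℕ → SF N → SF N
  | 0, ψ => ψ
  | m + 1, ψ => (Titer θ m ψ).Dsd + delta0 (darbIter θ m m) * Titer θ m ψ

/-- Determinant of a matrix of superfields: Leibniz formula with rows in
ascending order (for matrices of commuting, e.g. even, entries this is the usual
determinant, and when exactly one row is odd it agrees with the Laplace
expansion along that row). -/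
def detSF {N k : ℕ} (M : Matrix (Fin k) (Fin k) (SF N)) : SF N :=
  ∑ σ : Equiv.Perm (Fin k),
    ((Equiv.Perm.sign σ : ℤ)) • (((List.finRange k).map fun i => M i (σ i)).prod)

/-- Entrywise `D`-derivative of a matrix of superfields. -/
def DmatSF {N m n : ℕ} (M : Matrix (Fin m) (Fin n) (SF N)) : Matrix (Fin m) (Fin n) (SF N) :=
  Matrix.of fun i j => (M i j).Dsd

/-- The embedding `Fin (k−1) → Fin k` skipping `j`. -/
def dropIdx {k : ℕ} (j : Fin k) (i : Fin (k - 1)) : Fin k :=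
  ⟨if i.1 < j.1 then i.1 else i.1 + 1, by
    have h1 := i.2; have h2 := j.2; split <;> omega⟩

/-- The minor of `M` obtained by deleting row `j` and column `i`. -/
def minorSF {N k : ℕ} (M : Matrix (Fin k) (Fin k) (SF N)) (j i : Fin k) :
    Matrix (Fin (k-1)) (Fin (k-1)) (SF N) :=
  M.submatrix (dropIdx j) (dropIdx i)

/-- Adjugate matrix (matrix of cofactors, transposed). -/
def adjSF {N k : ℕ} (M : Matrix (Fin k) (Fin k) (SF N)) : Matrix (Fin k) (Fin k) (SF N) :=
  Matrix.of fun i j => ((-1 : ℤ) ^ (i.1 + j.1)) • detSF (minorSF M j i)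

/-- Inverse of a matrix of (even) superfields, via the adjugate
(junk unless `detSF M` is invertible). -/
def invSF {N k : ℕ} (M : Matrix (Fin k) (Fin k) (SF N)) : Matrix (Fin k) (Fin k) (SF N) :=
  Matrix.of fun i j => (detSF M).sinv * adjSF M i j

section EvenWronskian

variable {N : ℕ}

/-- `θ^{(0)} = (θ₀, θ₂, …)`. -/
def evenSeq (θ : ℕ → SF N) : ℕ → SF N := fun j => θ (2 * j)

/-- `θ^{(1)} = (θ₁, θ₃, …)`. -/
def oddSeq (θ : ℕ → SF N) : ℕ → SF N := fun j => θ (2 * j + 1)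

/-- The `k×k` Wronski matrix with rows `v, ∂v, …, ∂^{k−1}v`. -/
def Wmat (N : ℕ) (k : ℕ) (v : ℕ → SF N) : Matrix (Fin k) (Fin k) (SF N) :=
  Matrix.of fun i j => Xpow i.1 (v j.1)

/-- The Wronski matrix with last row replaced by `∂^k v`. -/
def WmatHat (N : ℕ) (k : ℕ) (v : ℕ → SF N) : Matrix (Fin k) (Fin k) (SF N) :=
  Matrix.of fun i j => if i.1 = k - 1 then Xpow k (v j.1) else Xpow i.1 (v j.1)

/-- The Wronski matrix with rows `Dv, D∂v, …, D∂^{k−2}v` and last row `∂^k v`. -/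
def WmatBarD (N : ℕ) (k : ℕ) (v : ℕ → SF N) : Matrix (Fin k) (Fin k) (SF N) :=
  Matrix.of fun i j => if i.1 = k - 1 then Xpow k (v j.1) else (Xpow i.1 (v j.1)).Dsd

/-- `W^{(0)}` (even case, `n = 2k`). -/
def W0E (N k : ℕ) (θ : ℕ → SF N) : Matrix (Fin k) (Fin k) (SF N) := Wmat N k (evenSeq θ)

/-- `W^{(1)}` (even case, `n = 2k`). -/
def W1E (N k : ℕ) (θ : ℕ → SF N) : Matrix (Fin k) (Fin k) (SF N) := Wmat N k (oddSeq θ)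

/-- The Schur complement `W^{(0)} − W^{(1)}(DW^{(1)})⁻¹DW^{(0)}`. -/
def SchurE (N k : ℕ) (θ : ℕ → SF N) : Matrix (Fin k) (Fin k) (SF N) :=
  W0E N k θ - W1E N k θ * invSF (DmatSF (W1E N k θ)) * DmatSF (W0E N k θ)

/-- The Schur complement `DW^{(1)} − (DW^{(0)})(W^{(0)})⁻¹W^{(1)}`. -/
def SchurE2 (N k : ℕ) (θ : ℕ → SF N) : Matrix (Fin k) (Fin k) (SF N) :=
  DmatSF (W1E N k θ) - DmatSF (W0E N k θ) * invSF (W0E N k θ) * W1E N k θ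

/-- `sdet 𝒲` (even case). -/
def sdetE (N k : ℕ) (θ : ℕ → SF N) : SF N :=
  detSF (SchurE N k θ) * (detSF (DmatSF (W1E N k θ))).sinv

/-- The Schur complement of the block matrix `𝒲̂` (even case). -/
def SchurEHat (N k : ℕ) (θ : ℕ → SF N) : Matrix (Fin k) (Fin k) (SF N) :=
  WmatHat N k (evenSeq θ) - WmatHat N k (oddSeq θ) * invSF (DmatSF (W1E N k θ)) * DmatSF (W0E N k θ)

/-- `sdet 𝒲̂` (even case). -/
def sdetEHat (N k : ℕ) (θ : ℕ → SF N) : SF N :=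
  detSF (SchurEHat N k θ) * (detSF (DmatSF (W1E N k θ))).sinv

end EvenWronskian

section OddWronskian

/-- `W^{(0)}`, a `(k+1)×(k+1)` matrix (odd case, `n = 2k+1`). -/
def W0O (N k : ℕ) (θ : ℕ → SF N) : Matrix (Fin (k+1)) (Fin (k+1)) (SF N) :=
  Matrix.of fun i j => Xpow i.1 (θ (2 * j.1))

/-- `W^{(1)}`, a `(k+1)×k` matrix (odd case). -/
def W1O (N k : ℕ) (θ : ℕ → SF N) : Matrix (Fin (k+1)) (Fin k) (SF N) :=
  Matrix.of fun i j => Xpow i.1 (θ (2 * j.1 + 1))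

/-- `W̃^{(0)}`: `W^{(0)}` with its last row removed. -/
def Wtil0 (N k : ℕ) (θ : ℕ → SF N) : Matrix (Fin k) (Fin (k+1)) (SF N) :=
  Matrix.of fun i j => Xpow i.1 (θ (2 * j.1))

/-- `W̃^{(1)}`: `W^{(1)}` with its last row removed. -/
def Wtil1 (N k : ℕ) (θ : ℕ → SF N) : Matrix (Fin k) (Fin k) (SF N) :=
  Matrix.of fun i j => Xpow i.1 (θ (2 * j.1 + 1))

/-- `W̌^{(0)}`: `W^{(0)}` with its second-to-last row removed. -/
def Wchk0 (N k : ℕ) (θ : ℕ → SF N) : Matrix (Fin k) (Fin (k+1)) (SF N) :=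
  Matrix.of fun i j => Xpow (if i.1 = k - 1 then k else i.1) (θ (2 * j.1))

/-- `W̌^{(1)}`: `W^{(1)}` with its second-to-last row removed. -/
def Wchk1 (N k : ℕ) (θ : ℕ → SF N) : Matrix (Fin k) (Fin k) (SF N) :=
  Matrix.of fun i j => Xpow (if i.1 = k - 1 then k else i.1) (θ (2 * j.1 + 1))

/-- `Ŵ^{(0)}`: `W^{(0)}` with last row `∂^k θ^{(0)}` replaced by `D∂^k θ^{(0)}`. -/
def W0OHat (N k : ℕ) (θ : ℕ → SF N) : Matrix (Fin (k+1)) (Fin (k+1)) (SF N) :=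
  Matrix.of fun i j => if i.1 = k then Dpow (2*k+1) (θ (2 * j.1)) else Xpow i.1 (θ (2 * j.1))

/-- `Ŵ^{(1)}`: `W^{(1)}` with last row `∂^k θ^{(1)}` replaced by `D∂^k θ^{(1)}`. -/
def W1OHat (N k : ℕ) (θ : ℕ → SF N) : Matrix (Fin (k+1)) (Fin k) (SF N) :=
  Matrix.of fun i j => if i.1 = k then Dpow (2*k+1) (θ (2 * j.1 + 1)) else Xpow i.1 (θ (2 * j.1 + 1))

/-- The Schur complement `W^{(0)} − W^{(1)}(DW̃^{(1)})⁻¹DW̃^{(0)}`. -/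
def SchurO (N k : ℕ) (θ : ℕ → SF N) : Matrix (Fin (k+1)) (Fin (k+1)) (SF N) :=
  W0O N k θ - W1O N k θ * invSF (DmatSF (Wtil1 N k θ)) * DmatSF (Wtil0 N k θ)

/-- The Schur complement `W^{(0)} − W^{(1)}(DW̌^{(1)})⁻¹DW̌^{(0)}`. -/
def SchurOchk (N k : ℕ) (θ : ℕ → SF N) : Matrix (Fin (k+1)) (Fin (k+1)) (SF N) :=
  W0O N k θ - W1O N k θ * invSF (DmatSF (Wchk1 N k θ)) * DmatSF (Wchk0 N k θ)

/-- The Schur complement `Ŵ^{(0)} − Ŵ^{(1)}(DW̃^{(1)})⁻¹DW̃^{(0)}`. -/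
def SchurOHat (N k : ℕ) (θ : ℕ → SF N) : Matrix (Fin (k+1)) (Fin (k+1)) (SF N) :=
  W0OHat N k θ - W1OHat N k θ * invSF (DmatSF (Wtil1 N k θ)) * DmatSF (Wtil0 N k θ)

/-- `sdet 𝒲` (odd case). -/
def sdetO (N k : ℕ) (θ : ℕ → SF N) : SF N :=
  detSF (SchurO N k θ) * (detSF (DmatSF (Wtil1 N k θ))).sinv

/-- `sdet 𝒲̌` (odd case). -/
def sdetOchk (N k : ℕ) (θ : ℕ → SF N) : SF N :=
  detSF (SchurOchk N k θ) * (detSF (DmatSF (Wchk1 N k θ))).sinv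

/-- The quotient `det(Ŵ^{(0)} − Ŵ^{(1)}(DW̃^{(1)})⁻¹DW̃^{(0)}) / det(W^{(0)} − W^{(1)}(DW̃^{(1)})⁻¹DW̃^{(0)})`. -/
def Qodd (N k : ℕ) (θ : ℕ → SF N) : SF N :=
  detSF (SchurOHat N k θ) * (detSF (SchurO N k θ)).sinv

end OddWronskian

set_option linter.unusedVariables false
namespace SFAux
variable {N : ℕ}
open CliffordAlgebra

abbrev inv' (x : SuperAlg N) : SuperAlg N :=
  CliffordAlgebra.involute (Q := (0 : QuadraticForm ℝ (Fin N → ℝ))) x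

lemma exists_dec (x : SuperAlg N) : ∃ e ∈ LambdaEven N, ∃ o ∈ LambdaOdd N, e + o = x := by
  have h := (evenOdd_isCompl (Q := (0 : QuadraticForm ℝ (Fin N → ℝ)))).sup_eq_top
  have hx : x ∈ (evenOdd (0 : QuadraticForm ℝ (Fin N → ℝ)) 0) ⊔
    (evenOdd (0 : QuadraticForm ℝ (Fin N → ℝ)) 1) := by rw [h]; trivial
  obtain ⟨e, he, o, ho, h⟩ := Submodule.mem_sup.1 hx
  exact ⟨e, he, o, ho, h⟩

lemma eq_zero_of_add_self {x : SuperAlg N} (h : x + x = 0) : x = 0 := by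
  have h2 : (2:ℝ) • x = 0 := by rw [two_smul]; exact h
  simpa using h2

lemma inv_even {x : SuperAlg N} (h : x ∈ LambdaEven N) : inv' x = x := involute_eq_of_mem_even h
lemma inv_odd {x : SuperAlg N} (h : x ∈ LambdaOdd N) : inv' x = -x := involute_eq_of_mem_odd h

lemma mem_even_iff (x : SuperAlg N) : x ∈ LambdaEven N ↔ inv' x = x := by
  refine ⟨inv_even, fun h => ?_⟩
  obtain ⟨e, he, o, ho, rfl⟩ := exists_dec x
  have h1 : inv' (e + o) = e - o := by
    rw [inv', map_add]; change inv' e + inv' o = _; rw [inv_even he, inv_odd ho, sub_eq_add_neg]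
  rw [h1] at h
  have : o = 0 := eq_zero_of_add_self (by
    have : o + o = (e + o) - (e - o) := by abel
    rw [this, ← h]; abel)
  simpa [this] using he

lemma mem_odd_iff (x : SuperAlg N) : x ∈ LambdaOdd N ↔ inv' x = -x := by
  refine ⟨inv_odd, fun h => ?_⟩
  obtain ⟨e, he, o, ho, rfl⟩ := exists_dec x
  have h1 : inv' (e + o) = e - o := by
    rw [inv', map_add]; change inv' e + inv' o = _; rw [inv_even he, inv_odd ho, sub_eq_add_neg]
  rw [h1] at h
  have : e = 0 := eq_zero_of_add_self (by
    have : e + e = (e - o) + (e + o) := by abel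
    rw [this, h]; abel)
  simpa [this] using ho

lemma ortho0 (x y : Fin N → ℝ) : QuadraticMap.IsOrtho (0 : QuadraticForm ℝ (Fin N → ℝ))
    ((QuadraticMap.Isometry.id (0 : QuadraticForm ℝ (Fin N → ℝ))) x)
    ((QuadraticMap.Isometry.id (0 : QuadraticForm ℝ (Fin N → ℝ))) y) := by
  simp [QuadraticMap.IsOrtho]

lemma comm_even {x : SuperAlg N} (hx : x ∈ LambdaEven N) (y : SuperAlg N) : x * y = y * x := by
  obtain ⟨e, he, o, ho, rfl⟩ := exists_dec y
  have h1 := commute_map_mul_map_of_isOrtho_of_mem_evenOdd_zero_left _ _ ortho0 x e hx he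
  have h2 := commute_map_mul_map_of_isOrtho_of_mem_evenOdd_zero_left _ _ ortho0 x o hx ho
  simp only [CliffordAlgebra.map_id, AlgHom.id_apply] at h1 h2
  rw [mul_add, add_mul]
  exact congrArg₂ _ h1.eq h2.eq

lemma anti_odd {x y : SuperAlg N} (hx : x ∈ LambdaOdd N) (hy : y ∈ LambdaOdd N) :
    x * y = -(y * x) := by
  have h1 := map_mul_map_eq_neg_of_isOrtho_of_mem_evenOdd_one _ _ ortho0 x y hx hy
  simp only [CliffordAlgebra.map_id, AlgHom.id_apply] at h1
  rw [← neg_mul]; exact h1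

lemma comm_odd {x : SuperAlg N} (hx : x ∈ LambdaOdd N) (y : SuperAlg N) :
    x * y = inv' y * x := by
  obtain ⟨e, he, o, ho, rfl⟩ := exists_dec y
  have : inv' (e + o) = e - o := by
    rw [inv', map_add]; change inv' e + inv' o = _; rw [inv_even he, inv_odd ho, sub_eq_add_neg]
  rw [this, mul_add, sub_mul, anti_odd hx ho, comm_even he x, sub_eq_add_neg]

lemma mul_c0 (f g : SF N) (x t) : (f * g).c0 x t = f.c0 x t * g.c0 x t := rfl
lemma mul_c1 (f g : SF N) (x t) : (f * g).c1 x t =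
  f.c1 x t * g.c0 x t + inv' (f.c0 x t) * g.c1 x t := rfl

lemma add_c0 (f g : SF N) (x t) : (f + g).c0 x t = f.c0 x t + g.c0 x t := rfl
lemma add_c1 (f g : SF N) (x t) : (f + g).c1 x t = f.c1 x t + g.c1 x t := rfl

local instance instRing : Ring (SF N) :=
  { (inferInstance : AddCommGroup (SF N)), (inferInstance : Mul (SF N)),
    (inferInstance : One (SF N)) with
    left_distrib := fun a b c => by
      refine SF.ext ?_ ?_ <;> funext x t
      · exact mul_add _ _ _
      · simp only [mul_c1, add_c0, add_c1, mul_add]; abel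
    right_distrib := fun a b c => by
      refine SF.ext ?_ ?_ <;> funext x t
      · exact add_mul _ _ _
      · simp only [mul_c1, add_c0, add_c1, inv', map_add, add_mul]; abel
    zero_mul := fun a => by
      refine SF.ext ?_ ?_ <;> funext x t
      · exact zero_mul _
      · change 0 * _ + involute 0 * _ = 0
        simp
    mul_zero := fun a => by
      refine SF.ext ?_ ?_ <;> funext x t
      · exact mul_zero _
      · change _ * 0 + _ * 0 = 0
        simp
    mul_assoc := fun a b c => by
      refine SF.ext ?_ ?_ <;> funext x t
      · exact mul_assoc _ _ _
      · simp only [mul_c1, mul_c0, inv', map_mul, add_mul, mul_add, mul_assoc]; abel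
    one_mul := fun a => by
      refine SF.ext ?_ ?_ <;> funext x t
      · exact one_mul _
      · change 0 * _ + involute 1 * _ = _
        simp
    mul_one := fun a => by
      refine SF.ext ?_ ?_ <;> funext x t
      · exact mul_one _
      · change _ * 1 + _ * 0 = _
        simp }

lemma ee {x y : SuperAlg N} (hx : x ∈ LambdaEven N) (hy : y ∈ LambdaEven N) :
    x * y ∈ LambdaEven N := by
  rw [mem_even_iff] at *; rw [inv', map_mul]; exact congrArg₂ _ hx hy
lemma eo {x y : SuperAlg N} (hx : x ∈ LambdaEven N) (hy : y ∈ LambdaOdd N) :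
    x * y ∈ LambdaOdd N := by
  rw [mem_odd_iff] at *; rw [mem_even_iff] at hx; rw [inv', map_mul, ← mul_neg]; exact congrArg₂ _ hx hy
lemma oe {x y : SuperAlg N} (hx : x ∈ LambdaOdd N) (hy : y ∈ LambdaEven N) :
    x * y ∈ LambdaOdd N := by
  rw [← comm_even hy]; exact eo hy hx
lemma oo {x y : SuperAlg N} (hx : x ∈ LambdaOdd N) (hy : y ∈ LambdaOdd N) :
    x * y ∈ LambdaEven N := by
  rw [mem_odd_iff] at hx hy; rw [mem_even_iff]; rw [inv', map_mul, ← neg_mul_neg x y]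
  exact congrArg₂ _ hx hy

/-- even superfields -/
def E (N : ℕ) : Subring (SF N) where
  carrier := {f | f.IsEven}
  mul_mem' := fun {f g} hf hg => ⟨fun x t => ee (hf.1 x t) (hg.1 x t), fun x t => by
    rw [mul_c1, inv_even (hf.1 x t)]
    exact add_mem (oe (hf.2 x t) (hg.1 x t)) (eo (hf.1 x t) (hg.2 x t))⟩
  one_mem' := ⟨fun x t => (mem_even_iff _).2 (map_one _), fun x t => zero_mem _⟩
  add_mem' := fun {f g} hf hg => ⟨fun x t => add_mem (hf.1 x t) (hg.1 x t),
    fun x t => add_mem (hf.2 x t) (hg.2 x t)⟩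
  zero_mem' := ⟨fun x t => zero_mem _, fun x t => zero_mem _⟩
  neg_mem' := fun {f} hf => ⟨fun x t => neg_mem (hf.1 x t), fun x t => neg_mem (hf.2 x t)⟩

/-- odd superfields -/
def O (N : ℕ) : AddSubgroup (SF N) where
  carrier := {f | f.IsOdd}
  add_mem' := fun {f g} hf hg => ⟨fun x t => add_mem (hf.1 x t) (hg.1 x t),
    fun x t => add_mem (hf.2 x t) (hg.2 x t)⟩
  zero_mem' := ⟨fun x t => zero_mem _, fun x t => zero_mem _⟩
  neg_mem' := fun {f} hf => ⟨fun x t => neg_mem (hf.1 x t), fun x t => neg_mem (hf.2 x t)⟩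

lemma E_comm {f : SF N} (hf : f ∈ E N) (g : SF N) : f * g = g * f := by
  refine SF.ext ?_ ?_ <;> funext x t
  · exact comm_even (hf.1 x t) _
  · rw [mul_c1, mul_c1, inv_even (hf.1 x t), comm_odd (hf.2 x t), comm_even (hf.1 x t), add_comm]

lemma O_anti {f g : SF N} (hf : f ∈ O N) (hg : g ∈ O N) : f * g = -(g * f) := by
  refine SF.ext ?_ ?_ <;> funext x t
  · exact anti_odd (hf.1 x t) (hg.1 x t)
  · change _ = -((g * f).c1 x t)
    rw [mul_c1, mul_c1, inv_odd (hf.1 x t), inv_odd (hg.1 x t), comm_even (hf.2 x t),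
      comm_even (hg.2 x t), neg_mul, neg_mul]; abel

lemma O_sq {f : SF N} (hf : f ∈ O N) : f * f = 0 := by
  refine SF.ext ?_ ?_ <;> funext x t
  · exact eq_zero_of_add_self (by
      have := anti_odd (hf.1 x t) (hf.1 x t)
      rw [mul_c0]; nth_rewrite 1 [this]; simp)
  · change _ = (0 : SuperAlg N)
    rw [mul_c1, inv_odd (hf.1 x t), comm_even (hf.2 x t), neg_mul]; abel

lemma OO {f g : SF N} (hf : f ∈ O N) (hg : g ∈ O N) : f * g ∈ E N :=
  ⟨fun x t => oo (hf.1 x t) (hg.1 x t), fun x t => by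
    rw [mul_c1, inv_odd (hf.1 x t), neg_mul, ← sub_eq_add_neg]
    exact sub_mem (eo (hf.2 x t) (hg.1 x t)) (oe (hf.1 x t) (hg.2 x t))⟩

lemma EO {f g : SF N} (hf : f ∈ E N) (hg : g ∈ O N) : f * g ∈ O N :=
  ⟨fun x t => eo (hf.1 x t) (hg.1 x t), fun x t => by
    rw [mul_c1, inv_even (hf.1 x t)]
    exact add_mem (oo (hf.2 x t) (hg.1 x t)) (ee (hf.1 x t) (hg.2 x t))⟩

lemma OE {f g : SF N} (hf : f ∈ O N) (hg : g ∈ E N) : f * g ∈ O N := by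
  rw [← E_comm hg]; exact EO hg hf

local instance instCR : CommRing (E N) :=
  { (inferInstance : Ring (E N)) with
    mul_comm := fun a b => Subtype.ext (E_comm a.2 b.1) }

lemma inverse_even {x : SuperAlg N} (hx : x ∈ LambdaEven N) (hu : IsUnit x) :
    Ring.inverse x ∈ LambdaEven N := by
  rw [mem_even_iff]
  have h : inv' (Ring.inverse x) * x = 1 := by
    have : inv' (Ring.inverse x) * inv' x = 1 := by
      rw [inv', inv', ← map_mul, Ring.inverse_mul_cancel _ hu, map_one]
    rwa [inv_even hx] at this
  calc inv' (Ring.inverse x) = inv' (Ring.inverse x) * (x * Ring.inverse x) := by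
        rw [Ring.mul_inverse_cancel _ hu, mul_one]
    _ = _ := by rw [← mul_assoc, h, one_mul]

lemma sinv_mem {f : SF N} (hf : f.IsEven) (hi : f.Invertible) : f.sinv ∈ E N := by
  refine ⟨fun x t => inverse_even (hf.1 x t) (hi x t), fun x t => ?_⟩
  change -(Ring.inverse (inv' (f.c0 x t)) * f.c1 x t * Ring.inverse (f.c0 x t)) ∈ _
  rw [inv_even (hf.1 x t)]
  have := inverse_even (hf.1 x t) (hi x t)
  exact neg_mem (oe (eo this (hf.2 x t)) this)

lemma mul_sinv {f : SF N} (hf : f.IsEven) (hi : f.Invertible) : f * f.sinv = 1 := by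
  refine SF.ext ?_ ?_ <;> funext x t
  · exact Ring.mul_inverse_cancel _ (hi x t)
  · rw [mul_c1]
    change f.c1 x t * Ring.inverse (f.c0 x t) + inv' (f.c0 x t) *
      -(Ring.inverse (inv' (f.c0 x t)) * f.c1 x t * Ring.inverse (f.c0 x t)) = 0
    rw [inv_even (hf.1 x t), mul_neg, ← mul_assoc, ← mul_assoc,
      Ring.mul_inverse_cancel _ (hi x t), one_mul, add_neg_cancel]

lemma derLam_mem (p : Submodule ℝ (SuperAlg N)) (g : ℝ → SuperAlg N) (hg : ∀ x, g x ∈ p) (x : ℝ) :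
    derLam g x ∈ p := by
  unfold derLam
  split_ifs with h
  · by_contra hn
    obtain ⟨l, hl, hp⟩ := Submodule.exists_le_ker_of_notMem hn
    have h1 := h.choose_spec l
    have h2 : (fun y => l (g y)) = fun _ => (0:ℝ) := funext fun y => hp (hg y)
    rw [h2] at h1
    exact hl (h1.unique (hasDerivAt_const x (0:ℝ)))
  · exact zero_mem _

lemma dx_E {f : SF N} (hf : f ∈ E N) : f.dx ∈ E N :=
  ⟨fun x t => derLam_mem _ _ (fun y => hf.1 y t) x, fun x t => derLam_mem _ _ (fun y => hf.2 y t) x⟩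
lemma dx_O {f : SF N} (hf : f ∈ O N) : f.dx ∈ O N :=
  ⟨fun x t => derLam_mem _ _ (fun y => hf.1 y t) x, fun x t => derLam_mem _ _ (fun y => hf.2 y t) x⟩
lemma D_E {f : SF N} (hf : f ∈ E N) : f.Dsd ∈ O N :=
  ⟨fun x t => hf.2 x t, fun x t => derLam_mem _ _ (fun y => hf.1 y t) x⟩
lemma D_O {f : SF N} (hf : f ∈ O N) : f.Dsd ∈ E N :=
  ⟨fun x t => hf.2 x t, fun x t => derLam_mem _ _ (fun y => hf.1 y t) x⟩
lemma X_E {f : SF N} (hf : f ∈ E N) (m : ℕ) : Xpow m f ∈ E N := by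
  induction m with
  | zero => exact hf
  | succ m ih => exact dx_E ih
lemma X_O {f : SF N} (hf : f ∈ O N) (m : ℕ) : Xpow m f ∈ O N := by
  induction m with
  | zero => exact hf
  | succ m ih => exact dx_O ih
lemma Dpow_even (f : SF N) (m : ℕ) : Dpow (2 * m) f = Xpow m f := by
  induction m with
  | zero => rfl
  | succ m ih =>
    change ((Dpow (2 * m) f).Dsd).Dsd = (Xpow m f).dx
    rw [ih]; rfl
lemma Dpow_odd (f : SF N) (m : ℕ) : Dpow (2 * m + 1) f = (Xpow m f).Dsd := by
  change (Dpow (2 * m) f).Dsd = _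
  rw [Dpow_even]

/-- coercion of even matrices -/
def cm {m n : Type*} (M : Matrix m n (E N)) : Matrix m n (SF N) := M.map (E N).subtype

lemma cm_apply {m n : Type*} (M : Matrix m n (E N)) (i j) : cm M i j = (M i j : SF N) := rfl

lemma cm_mul {l m n : Type*} [Fintype m] (A : Matrix l m (E N)) (B : Matrix m n (E N)) :
    cm (A * B) = cm A * cm B := Matrix.map_mul

lemma cm_one {m : Type*} [DecidableEq m] : cm (1 : Matrix m m (E N)) = 1 :=
  Matrix.map_one _ (map_zero _) (map_one _)

lemma cm_inj {m n : Type*} {A B : Matrix m n (E N)} (h : cm A = cm B) : A = B := by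
  ext1 i j
  exact Subtype.ext (congrFun (congrFun h i) j)

lemma exists_cm {m n : Type*} (M : Matrix m n (SF N)) (h : ∀ i j, M i j ∈ E N) :
    ∃ M' : Matrix m n (E N), M = cm M' :=
  ⟨Matrix.of fun i j => ⟨M i j, h i j⟩, rfl⟩

lemma coe_prod {n : ℕ} (f : Fin n → E N) :
    ((List.finRange n).map fun i => (f i : SF N)).prod = ((∏ i, f i : E N) : SF N) := by
  rw [Fin.prod_univ_def, ← Subring.subtype_apply, map_list_prod, List.map_map]; rfl

lemma detSF_cm {n : ℕ} (M : Matrix (Fin n) (Fin n) (E N)) : detSF (cm M) = (M.det : SF N) := by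
  rw [← Matrix.det_transpose, Matrix.det_apply, ← Subring.subtype_apply, map_sum]
  refine Finset.sum_congr rfl fun σ _ => ?_
  rw [Units.smul_def, map_zsmul]
  congr 1
  exact coe_prod fun i => M i (σ i)

lemma detSF_last {n : ℕ} (S : Matrix (Fin (n+1)) (Fin (n+1)) (E N)) (b : Fin (n+1) → SF N)
    (T : Matrix (Fin (n+1)) (Fin (n+1)) (SF N))
    (hT : ∀ (i : Fin n) j, T i.castSucc j = S i.castSucc j)
    (hl : ∀ j, T (Fin.last n) j = ∑ i, b i * (S i j : SF N)) :
    detSF T = b (Fin.last n) * (S.det : SF N) := by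
  have key : ∀ i, (∑ σ : Equiv.Perm (Fin (n+1)), (Equiv.Perm.sign σ : ℤ) •
      ((∏ l : Fin n, S l.castSucc (σ l.castSucc)) * S i (σ (Fin.last n)))) =
      (S.updateRow (Fin.last n) (S i)).det := by
    intro i
    rw [← Matrix.det_transpose, Matrix.det_apply]
    refine Finset.sum_congr rfl fun σ _ => ?_
    rw [Units.smul_def, Fin.prod_univ_castSucc]
    congr 2
    · refine Finset.prod_congr rfl fun l _ => ?_
      rw [Matrix.transpose_apply, Matrix.updateRow_ne (Fin.castSucc_lt_last l).ne]
    · rw [Matrix.transpose_apply, Matrix.updateRow_self]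
  have key2 : ∀ i, i ≠ Fin.last n → (S.updateRow (Fin.last n) (S i)).det = 0 := by
    intro i hi
    refine Matrix.det_zero_of_row_eq hi ?_
    rw [Matrix.updateRow_self]
    funext j
    rw [Matrix.updateRow_ne hi]
  have h1 : detSF T = ∑ i, b i * ((S.updateRow (Fin.last n) (S i)).det : SF N) := by
    simp only [← key, ← Subring.subtype_apply, map_sum, map_zsmul, map_mul, Finset.mul_sum]
    rw [Finset.sum_comm]
    refine Finset.sum_congr rfl fun σ _ => ?_
    have h2 : ((List.finRange (n+1)).map fun i => T i (σ i)).prod =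
       ((∏ l : Fin n, S l.castSucc (σ l.castSucc) : E N) : SF N) * T (Fin.last n) (σ (Fin.last n)) := by
      rw [List.finRange_succ_last, List.map_append, List.prod_append, List.map_map, ← coe_prod]
      simp [Function.comp_def, hT]
    refine (congrArg _ h2).trans ?_
    rw [hl, Finset.mul_sum]
    refine (Finset.smul_sum (M := ℤ) (N := SF N)).trans ?_
    refine Finset.sum_congr rfl fun i _ => ?_
    rw [Subring.subtype_apply, ← mul_assoc, E_comm (SetLike.coe_mem _) (b i), mul_assoc, mul_smul_comm]
    rfl
  rw [h1, Finset.sum_eq_single (Fin.last n)]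
  · rw [Matrix.updateRow_eq_self]
  · intro i _ hi
    rw [key2 i hi]; exact mul_zero _
  · simp

lemma rank_one : ∀ (n : ℕ) (u β : Fin n → SF N) (hu : ∀ i, u i ∈ O N) (hβ : ∀ i, β i ∈ O N)
    (P : Matrix (Fin n) (Fin n) (E N)) (hP : ∀ i j, (P i j : SF N) = (1 : Matrix _ _ (SF N)) i j - u i * β j)
    (s : E N) (hs : (s : SF N) = 1 - ∑ i, β i * u i), P.det * s = 1 := by
  intro n
  induction n with
  | zero =>
    intro u β hu hβ P hP s hs
    have : s = 1 := Subtype.ext (by rw [hs]; simp)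
    simp [this]
  | succ n ih =>
    intro u β hu hβ P hP s hs
    let w : E N := ⟨β 0 * u 0, OO (hβ 0) (hu 0)⟩
    have hw : w * w = 0 := by
      apply Subtype.ext
      change β 0 * u 0 * (β 0 * u 0) = 0
      rw [mul_assoc, ← mul_assoc (u 0), O_anti (hu 0) (hβ 0), neg_mul, mul_assoc, O_sq (hu 0)]; simp
    have h00 : P 0 0 = 1 + w := by
      apply Subtype.ext
      rw [hP, O_anti (hu 0) (hβ 0)]; simp [w]
    let c : Fin (n+1) → E N := Fin.cons 0 fun i => ⟨-(u i.succ * β 0), neg_mem (OO (hu _) (hβ _))⟩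
    let B : Matrix (Fin (n+1)) (Fin (n+1)) (E N) := Matrix.of fun i j => P i j - c i * P 0 j
    have hdet : P.det = B.det := by
      refine Matrix.det_eq_of_forall_row_eq_smul_add_const c 0 rfl ?_
      intro i j
      have : c 0 = 0 := rfl
      simp [B, this]
    have hB0 : ∀ i : Fin n, B i.succ 0 = 0 := by
      intro i
      apply Subtype.ext
      change (P i.succ 0 : SF N) - (-(u i.succ * β 0)) * (P 0 0 : SF N) = 0
      rw [hP, hP]
      have : u i.succ * β 0 * (u 0 * β 0) = 0 := by
        rw [O_anti (hu 0) (hβ 0), mul_neg, mul_assoc, ← mul_assoc (β 0), O_sq (hβ 0)]; simp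
      simp only [Matrix.one_apply_eq, Matrix.one_apply_ne (Fin.succ_ne_zero i), neg_mul, mul_sub, this]
      simp
    let P' : Matrix (Fin n) (Fin n) (E N) := B.submatrix Fin.succ Fin.succ
    have hdB : B.det = (1 + w) * P'.det := by
      rw [Matrix.det_succ_column_zero, Fin.sum_univ_succ]
      have h0 : B 0 0 = 1 + w := by
        have : c 0 = 0 := rfl
        simp [B, this, h00]
      simp [hB0, h0, P']
    let q : SF N := 1 + (w : SF N)
    have hq : q ∈ E N := add_mem (one_mem _) w.2
    have hs' : (∑ i : Fin n, β i.succ * (u i.succ * q)) ∈ E N :=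
      sum_mem fun i _ => OO (hβ _) (OE (hu _) hq)
    have := ih (fun i => u i.succ * q) (fun i => β i.succ) (fun i => OE (hu _) hq) (fun i => hβ _)
      P' (by
        intro i j
        change (P i.succ j.succ : SF N) - (-(u i.succ * β 0)) * (P 0 j.succ : SF N) = _
        rw [hP, hP, Matrix.one_apply_ne (Fin.succ_ne_zero j).symm]
        have h1 : (1 : Matrix (Fin (n+1)) (Fin (n+1)) (SF N)) i.succ j.succ =
          (1 : Matrix (Fin n) (Fin n) (SF N)) i j := by
          simp [Matrix.one_apply]
        rw [h1]
        simp only [q, w]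
        noncomm_ring)
      (1 - ⟨_, hs'⟩) rfl
    have hs2 : s = (1 - w) * (1 - ⟨_, hs'⟩) := by
      have hx : (∑ i : Fin n, β i.succ * u i.succ) ∈ E N := sum_mem fun i _ => OO (hβ _) (hu _)
      have e1 : (⟨_, hs'⟩ : E N) = ⟨_, hx⟩ * (1 + w) := by
        apply Subtype.ext
        change _ = (∑ i : Fin n, β i.succ * u i.succ) * q
        simp [Finset.sum_mul, mul_assoc]
      have e2 : s = 1 - w - ⟨_, hx⟩ := by
        apply Subtype.ext
        rw [hs, Fin.sum_univ_succ]
        change _ = 1 - (β 0 * u 0) - _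
        abel
      rw [e1, e2]
      linear_combination (-⟨_, hx⟩ : E N) * hw
    rw [hdet, hdB, hs2]
    linear_combination (1 - w * w) * this - hw

lemma invSF_cm {n : ℕ} (M : Matrix (Fin (n+1)) (Fin (n+1)) (E N))
    (hi : (detSF (cm M)).Invertible) :
    ∃ R : Matrix (Fin (n+1)) (Fin (n+1)) (E N), invSF (cm M) = cm R ∧ M * R = 1 ∧ R * M = 1 := by
  have he : (detSF (cm M)).IsEven := by rw [detSF_cm]; exact M.det.2
  let d : E N := ⟨_, sinv_mem he hi⟩
  have hd : M.det * d = 1 := by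
    apply Subtype.ext
    change (M.det : SF N) * (detSF (cm M)).sinv = 1
    rw [← detSF_cm, mul_sinv he hi]
  refine ⟨d • M.adjugate, ?_, ?_, ?_⟩
  · ext1 i j
    change (detSF (cm M)).sinv * adjSF (cm M) i j = (detSF (cm M)).sinv * (M.adjugate i j : SF N)
    congr 1
    rw [Matrix.adjugate_fin_succ_eq_det_submatrix]
    have hdrop : ∀ j : Fin (n+1), (dropIdx j : Fin n → Fin (n+1)) = j.succAbove := by
      intro j; funext i
      ext
      simp only [dropIdx, Fin.succAbove, Fin.lt_def, Fin.val_castSucc]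
      split_ifs <;> simp
    have hm : minorSF (cm M) j i = cm (M.submatrix j.succAbove i.succAbove) := by
      unfold minorSF
      rw [← hdrop, ← hdrop]; rfl
    change ((-1 : ℤ) ^ (i.1 + j.1)) • detSF (minorSF (cm M) j i) = _
    rw [hm, detSF_cm, ← Subring.subtype_apply, ← Subring.subtype_apply, map_mul, map_pow, map_neg, map_one]
    refine (zsmul_eq_mul _ _).trans ?_
    push_cast
    rw [add_comm]
  · rw [Matrix.mul_smul, Matrix.mul_adjugate, smul_smul, mul_comm, hd, one_smul]
  · rw [Matrix.smul_mul, Matrix.adjugate_mul, smul_smul, mul_comm, hd, one_smul]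

lemma core1 {m : ℕ} (W0 : Matrix (Fin (m+2)) (Fin (m+2)) (SF N))
    (W1 : Matrix (Fin (m+2)) (Fin (m+1)) (SF N)) (D0 D0' : Matrix (Fin (m+1)) (Fin (m+2)) (SF N))
    (M M' R R' : Matrix (Fin (m+1)) (Fin (m+1)) (E N))
    (hR : M * R = 1) (hR' : M' * R' = 1) (hR2' : R' * M' = 1)
    (hW1 : ∀ i j, W1 i j ∈ O N)
    (b : Fin (m+2) → SF N) (hb : ∀ i, b i ∈ O N) (c : Fin (m+1) → E N)
    (B : Matrix (Fin (m+1)) (Fin (m+2)) (SF N)) (C : Matrix (Fin (m+1)) (Fin (m+1)) (E N))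
    (hB : B = Matrix.of fun i j => if i = Fin.last m then -b j else 0)
    (hC : C = Matrix.of fun i j => if i = Fin.last m then -c j else (1 : Matrix _ _ (E N)) i j)
    (hD0' : D0' = B * W0 + cm C * D0) (hM' : cm M' = B * W1 + cm C * cm M)
    (S S' : Matrix (Fin (m+2)) (Fin (m+2)) (E N))
    (hS : W0 - W1 * cm R * D0 = cm S) (hS' : W0 - W1 * cm R' * D0' = cm S') :
    S'.det * (-c (Fin.last m) * M.det * R'.det) = S.det := by
  have hRc : cm M * cm R = 1 := by rw [← cm_mul, hR, cm_one]
  have hRc2' : cm R' * cm M' = 1 := by rw [← cm_mul, hR2', cm_one]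
  have hRc' : cm M' * cm R' = 1 := by rw [← cm_mul, hR', cm_one]
  let u : Fin (m+2) → SF N := fun i => (W1 * cm R') i (Fin.last m)
  have hu : ∀ i, u i ∈ O N := fun i => sum_mem fun j _ => OE (hW1 i j) (SetLike.coe_mem _)
  have hP0 : ∀ i j, (1 - W1 * cm R' * B : Matrix (Fin (m+2)) (Fin (m+2)) (SF N)) i j = (1 : Matrix _ _ (SF N)) i j - u i * (-b j) := by
    intro i j
    rw [Matrix.sub_apply, Matrix.mul_apply, hB]
    simp [u]
  obtain ⟨P, hP⟩ := exists_cm (1 - W1 * cm R' * B) (by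
    intro i j
    rw [hP0]
    refine sub_mem ?_ (OO (hu i) (neg_mem (hb j)))
    rw [Matrix.one_apply]
    split_ifs
    · exact one_mem _
    · exact zero_mem _)
  have hPS : S' = P * S := by
    apply cm_inj
    rw [cm_mul, ← hP, ← hS, ← hS', hD0']
    have h1 : B * W1 = cm M' - cm C * cm M := by rw [hM']; abel
    have h2 : B * (W1 * cm R * D0) = cm M' * cm R * D0 - cm C * D0 := by
      rw [← Matrix.mul_assoc, ← Matrix.mul_assoc, h1, Matrix.sub_mul, Matrix.mul_assoc (cm C), hRc,
        Matrix.mul_one, Matrix.sub_mul]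
    have h3 : W1 * cm R' * (cm M' * cm R * D0) = W1 * cm R * D0 := by
      simp only [Matrix.mul_assoc]
      rw [← Matrix.mul_assoc (cm R') (cm M'), hRc2', Matrix.one_mul]
    rw [Matrix.sub_mul, Matrix.one_mul, Matrix.mul_assoc _ B, Matrix.mul_sub B, h2, Matrix.mul_sub,
      Matrix.mul_sub, h3, Matrix.mul_add]
    abel
  -- the one by one side
  let F : Matrix (Fin (m+1)) (Fin (m+1)) (E N) := C * M * R'
  have hF : cm F = 1 - B * (W1 * cm R') := by
    have h1 : cm C * cm M = cm M' - B * W1 := by rw [hM']; abel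
    rw [cm_mul, cm_mul, h1, Matrix.sub_mul, hRc', Matrix.mul_assoc]
  have hFl : ∀ (i : Fin (m+1)) j, i ≠ Fin.last m → F i j = (1 : Matrix _ _ (E N)) i j := by
    intro i j hi
    apply Subtype.ext
    have h1 := congrFun (congrFun hF i) j
    rw [cm_apply] at h1
    rw [h1, Matrix.sub_apply, Matrix.mul_apply, hB]
    simp only [Matrix.of_apply, if_neg hi, zero_mul, Finset.sum_const_zero, sub_zero]
    rw [← cm_one]; rfl
  have hFs : (F (Fin.last m) (Fin.last m) : SF N) = 1 - ∑ i, (-b i) * u i := by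
    have h1 := congrFun (congrFun hF (Fin.last m)) (Fin.last m)
    rw [cm_apply] at h1
    rw [h1, Matrix.sub_apply, Matrix.mul_apply, hB]
    simp [u]
  have htri : ∀ X : Matrix (Fin (m+1)) (Fin (m+1)) (E N),
      (∀ i j, i ≠ Fin.last m → X i j = (1 : Matrix _ _ (E N)) i j) →
      X.det = X (Fin.last m) (Fin.last m) := by
    intro X hX
    rw [Matrix.det_of_isLowerTriangular (M := X), Fin.prod_univ_castSucc, Finset.prod_eq_one, one_mul]
    · intro i _
      rw [hX _ _ (Fin.castSucc_lt_last i).ne, Matrix.one_apply_eq]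
    · intro i j hij
      have hij : i < j := hij
      rw [hX i j (ne_of_lt (lt_of_lt_of_le hij (Fin.le_last j))), Matrix.one_apply_ne hij.ne]
  have hrk := rank_one _ u (fun j => -b j) hu (fun j => neg_mem (hb j)) P
    (fun i j => by rw [← hP0, hP]; rfl) (F (Fin.last m) (Fin.last m)) hFs
  have hCd : C.det = -c (Fin.last m) := by
    rw [htri C]
    · simp [hC]
    · intro i j hi; simp [hC, hi]
  rw [← htri F hFl, Matrix.det_mul, Matrix.det_mul, hCd] at hrk
  rw [hPS, Matrix.det_mul]
  linear_combination S.det * hrk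

lemma core2 {m : ℕ} (W0 : Matrix (Fin (m+2)) (Fin (m+2)) (SF N))
    (W1 : Matrix (Fin (m+2)) (Fin (m+1)) (SF N)) (D0 : Matrix (Fin (m+1)) (Fin (m+2)) (SF N))
    (M R : Matrix (Fin (m+1)) (Fin (m+1)) (E N)) (hR : M * R = 1)
    (b : Fin (m+2) → SF N) (c : Fin (m+1) → SF N)
    (W0h : Matrix (Fin (m+2)) (Fin (m+2)) (SF N)) (W1h : Matrix (Fin (m+2)) (Fin (m+1)) (SF N))
    (h0 : ∀ (i : Fin (m+1)) j, W0h i.castSucc j = W0 i.castSucc j)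
    (h1 : ∀ (i : Fin (m+1)) j, W1h i.castSucc j = W1 i.castSucc j)
    (hr0 : W0h (Fin.last _) = -(Matrix.vecMul b W0 + Matrix.vecMul c D0))
    (hr1 : W1h (Fin.last _) = -(Matrix.vecMul b W1 + Matrix.vecMul c (cm M)))
    (S : Matrix (Fin (m+2)) (Fin (m+2)) (E N)) (hS : W0 - W1 * cm R * D0 = cm S) :
    detSF (W0h - W1h * cm R * D0) = -(b (Fin.last _) * (S.det : SF N)) := by
  have hRc : cm M * cm R = 1 := by rw [← cm_mul, hR, cm_one]
  rw [← neg_mul]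
  refine detSF_last S (fun i => -b i) _ ?_ ?_
  · intro i j
    rw [← cm_apply, ← hS]
    simp only [Matrix.sub_apply, Matrix.mul_apply, h0, h1]
  · have hrow : (W0h - W1h * cm R * D0) (Fin.last _) = -(Matrix.vecMul b (cm S)) := by
      have e1 : (W0h - W1h * cm R * D0) (Fin.last _) =
          W0h (Fin.last _) - Matrix.vecMul (Matrix.vecMul (W1h (Fin.last _)) (cm R)) D0 := by
        funext j; rfl
      rw [e1, hr0, hr1, ← hS, Matrix.neg_vecMul, Matrix.add_vecMul, Matrix.vecMul_vecMul,
        Matrix.vecMul_vecMul, hRc, Matrix.vecMul_one, Matrix.neg_vecMul, Matrix.add_vecMul,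
        Matrix.vecMul_vecMul, Matrix.vecMul_sub]
      abel
    intro j
    rw [hrow]
    simp [Matrix.vecMul, dotProduct, cm_apply]

lemma sum_split {A : Type*} [AddCommMonoid A] (f : ℕ → A) (k : ℕ) :
    ∑ i : Fin (2*k+1), f i = ∑ i : Fin (k+1), f (2 * i) + ∑ i : Fin k, f (2 * i + 1) := by
  rw [Fin.sum_univ_eq_sum_range f, Fin.sum_univ_eq_sum_range (fun i => f (2 * i)),
    Fin.sum_univ_eq_sum_range (fun i => f (2 * i + 1))]
  induction k with
  | zero => simp
  | succ k ih =>
    rw [show 2 * (k+1) + 1 = (2 * k + 1) + 1 + 1 by ring, Finset.sum_range_succ,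
      Finset.sum_range_succ, ih, Finset.sum_range_succ _ (k+1), Finset.sum_range_succ _ k,
      Finset.sum_range_succ _ k]
    rw [show 2 * (k+1) = 2 * k + 1 + 1 by ring]
    abel


theorem main_aux {N : ℕ} (hN : 1 ≤ N) (k : ℕ) (hk : 1 ≤ k) (θ : ℕ → SF N)
    (hθs : ∀ j < 2*k+1, (θ j).Smooth) (hθp : ∀ j < 2*k+1, parityAt (θ j) j)
    (a : Fin (2*k+1) → SF N) (hap : ∀ i : Fin (2*k+1), parityAt (a i) (i.1 + 1))
    (has : ∀ i : Fin (2*k+1), (a i).Smooth)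
    (hker : ∀ j < 2*k+1,
      Dpow (2*k+1) (θ j) + ∑ i : Fin (2*k+1), a i * Dpow i.1 (θ j) = 0)
    (h1e : (detSF (DmatSF (Wtil1 N k θ))).IsEven)
    (h1i : (detSF (DmatSF (Wtil1 N k θ))).Invertible)
    (h2e : (detSF (DmatSF (Wchk1 N k θ))).IsEven)
    (h2i : (detSF (DmatSF (Wchk1 N k θ))).Invertible)
    (h3e : (detSF (SchurO N k θ)).IsEven)
    (h3i : (detSF (SchurO N k θ)).Invertible)
    (h4e : (detSF (SchurOchk N k θ)).IsEven)
    (h4i : (detSF (SchurOchk N k θ)).Invertible)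
    (hx1 : 2*k-1 < 2*k+1) (hx2 : 2*k < 2*k+1) :
    a ⟨2*k-1, hx1⟩ = -(sdetO N k θ * (sdetOchk N k θ).sinv) ∧
    a ⟨2*k, hx2⟩ = -(detSF (SchurOHat N k θ) * (detSF (SchurO N k θ)).sinv) := by
  obtain ⟨m, rfl⟩ : ∃ m, k = m + 1 := ⟨k - 1, by omega⟩
  have hθe : ∀ j, j < m + 2 → θ (2 * j) ∈ SFAux.E N := fun j hj => by
    have := hθp (2 * j) (by omega)
    unfold parityAt at this
    rwa [if_pos (by omega)] at this
  have hθo : ∀ j, j < m + 1 → θ (2 * j + 1) ∈ SFAux.O N := fun j hj => by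
    have := hθp (2 * j + 1) (by omega)
    unfold parityAt at this
    rwa [if_neg (by omega)] at this
  let b : Fin (m+2) → SF N := fun i => a ⟨2 * i.1, by omega⟩
  let c : Fin (m+1) → SF N := fun i => a ⟨2 * i.1 + 1, by omega⟩
  have hb : ∀ i, b i ∈ SFAux.O N := fun i => by
    have := hap ⟨2 * i.1, by omega⟩
    unfold parityAt at this
    rwa [if_neg (by dsimp only; omega)] at this
  have hc : ∀ i, c i ∈ SFAux.E N := fun i => by
    have := hap ⟨2 * i.1 + 1, by omega⟩
    unfold parityAt at this
    rwa [if_pos (by dsimp only; omega)] at this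
  have hker2 : ∀ j < 2 * (m + 1) + 1, (Xpow (m+1) (θ j)).Dsd =
      -(∑ i, b i * Xpow i.1 (θ j) + ∑ i, c i * (Xpow i.1 (θ j)).Dsd) := by
    intro j hj
    have h := hker j hj
    let f : ℕ → SF N := fun i => if h : i < 2 * (m + 1) + 1 then a ⟨i, h⟩ * Dpow i (θ j) else 0
    have e : ∑ i : Fin (2*(m+1)+1), a i * Dpow i.1 (θ j) = ∑ i : Fin (2*(m+1)+1), f i := by
      refine Finset.sum_congr rfl fun i _ => ?_
      simp only [f, dif_pos i.2]
    rw [e, SFAux.sum_split, SFAux.Dpow_odd] at h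
    have e1 : ∑ i : Fin (m+1+1), f (2 * i) = ∑ i, b i * Xpow i.1 (θ j) := by
      refine Finset.sum_congr rfl fun i _ => ?_
      simp only [f, b]
      rw [dif_pos (by omega), SFAux.Dpow_even]
    have e2 : ∑ i : Fin (m+1), f (2 * i + 1) = ∑ i, c i * (Xpow i.1 (θ j)).Dsd := by
      refine Finset.sum_congr rfl fun i _ => ?_
      simp only [f, c]
      rw [dif_pos (by omega), SFAux.Dpow_odd]
    rw [e1, e2] at h
    exact eq_neg_of_add_eq_zero_left h
  obtain ⟨M, hM⟩ := SFAux.exists_cm (DmatSF (Wtil1 N (m+1) θ))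
    (fun i j => SFAux.D_O (SFAux.X_O (hθo j.1 j.2) _))
  obtain ⟨M', hM'⟩ := SFAux.exists_cm (DmatSF (Wchk1 N (m+1) θ))
    (fun i j => SFAux.D_O (SFAux.X_O (hθo j.1 j.2) _))
  have hW1 : ∀ i j, W1O N (m+1) θ i j ∈ SFAux.O N := fun i j => SFAux.X_O (hθo j.1 j.2) _
  have hW0 : ∀ i j, W0O N (m+1) θ i j ∈ SFAux.E N := fun i j => SFAux.X_E (hθe j.1 j.2) _
  have hD0 : ∀ i j, DmatSF (Wtil0 N (m+1) θ) i j ∈ SFAux.O N :=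
    fun i j => SFAux.D_E (SFAux.X_E (hθe j.1 j.2) _)
  have hD0' : ∀ i j, DmatSF (Wchk0 N (m+1) θ) i j ∈ SFAux.O N :=
    fun i j => SFAux.D_E (SFAux.X_E (hθe j.1 j.2) _)
  obtain ⟨R, hRc, hR, hR2⟩ := SFAux.invSF_cm M (by rw [← hM]; exact h1i)
  obtain ⟨R', hRc', hR', hR2'⟩ := SFAux.invSF_cm M' (by rw [← hM']; exact h2i)
  have hSe : SchurO N (m+1) θ = W0O N (m+1) θ - W1O N (m+1) θ * SFAux.cm R * DmatSF (Wtil0 N (m+1) θ) := by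
    unfold SchurO; rw [hM, hRc]
  have hSe' : SchurOchk N (m+1) θ =
      W0O N (m+1) θ - W1O N (m+1) θ * SFAux.cm R' * DmatSF (Wchk0 N (m+1) θ) := by
    unfold SchurOchk; rw [hM', hRc']
  have hSh : SchurOHat N (m+1) θ =
      W0OHat N (m+1) θ - W1OHat N (m+1) θ * SFAux.cm R * DmatSF (Wtil0 N (m+1) θ) := by
    unfold SchurOHat; rw [hM, hRc]
  obtain ⟨S, hS⟩ := SFAux.exists_cm (SchurO N (m+1) θ) (fun i j => by
    rw [hSe]
    exact sub_mem (hW0 i j) (sum_mem fun l _ => SFAux.OO (sum_mem fun p _ =>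
      SFAux.OE (hW1 i p) (SetLike.coe_mem _)) (hD0 l j)))
  obtain ⟨S', hS'⟩ := SFAux.exists_cm (SchurOchk N (m+1) θ) (fun i j => by
    rw [hSe']
    exact sub_mem (hW0 i j) (sum_mem fun l _ => SFAux.OO (sum_mem fun p _ =>
      SFAux.OE (hW1 i p) (SetLike.coe_mem _)) (hD0' l j)))
  have hSd : detSF (SchurO N (m+1) θ) = (S.det : SF N) := by rw [hS, SFAux.detSF_cm]
  have hSd' : detSF (SchurOchk N (m+1) θ) = (S'.det : SF N) := by rw [hS', SFAux.detSF_cm]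
  constructor
  · let cE : Fin (m+1) → SFAux.E N := fun i => ⟨c i, hc i⟩
    have hmix : ∀ (n : ℕ) (g : Fin n → ℕ) (hg : ∀ j, g j < 2 * (m + 1) + 1),
        (Matrix.of fun (i : Fin (m+1)) (j : Fin n) =>
          (Xpow (if i.1 = m + 1 - 1 then m + 1 else i.1) (θ (g j))).Dsd) =
        (Matrix.of fun (i : Fin (m+1)) j => if i = Fin.last m then -b j else 0) *
          (Matrix.of fun (i : Fin (m+2)) (j : Fin n) => Xpow i.1 (θ (g j))) +
        SFAux.cm (Matrix.of fun i j => if i = Fin.last m then -cE j else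
          (1 : Matrix _ _ (SFAux.E N)) i j) *
          (Matrix.of fun (i : Fin (m+1)) (j : Fin n) => (Xpow i.1 (θ (g j))).Dsd) := by
      intro n g hg
      ext1 i j
      rw [Matrix.add_apply, Matrix.mul_apply, Matrix.mul_apply]
      by_cases hi : i = Fin.last m
      · subst hi
        simp only [Matrix.of_apply, SFAux.cm_apply, if_true, Fin.val_last]
        rw [if_pos (by omega), hker2 _ (hg j), neg_add, ← Finset.sum_neg_distrib,
          ← Finset.sum_neg_distrib]
        congr 1
        · exact Finset.sum_congr rfl fun l _ => (neg_mul _ _).symm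
        · exact Finset.sum_congr rfl fun l _ => (neg_mul _ _).symm
      · have hi' : i.1 ≠ m + 1 - 1 := fun h => hi (Fin.ext (by simpa using h))
        simp only [Matrix.of_apply, SFAux.cm_apply, if_neg hi, if_neg hi', zero_mul,
          Finset.sum_const_zero, zero_add]
        rw [Finset.sum_eq_single i]
        · simp
        · intro l _ hl
          rw [Matrix.one_apply_ne hl.symm]; exact zero_mul _
        · simp
    have key := SFAux.core1 (W0O N (m+1) θ) (W1O N (m+1) θ) (DmatSF (Wtil0 N (m+1) θ))
      (DmatSF (Wchk0 N (m+1) θ)) M M' R R' hR hR' hR2' hW1 b hb cE _ _ rfl rfl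
      (hmix (m+2) (fun j => 2 * j.1) (fun j => by have := j.2; omega))
      (by
        rw [← hM, ← hM']
        exact hmix (m+1) (fun j => 2 * j.1 + 1) (fun j => by have := j.2; omega))
      S S' (by rw [← hSe, hS]) (by rw [← hSe', hS'])
    have hMd : detSF (DmatSF (Wtil1 N (m+1) θ)) = (M.det : SF N) := by rw [hM, SFAux.detSF_cm]
    have hMd' : detSF (DmatSF (Wchk1 N (m+1) θ)) = (M'.det : SF N) := by rw [hM', SFAux.detSF_cm]
    let d : SFAux.E N := ⟨_, SFAux.sinv_mem h1e h1i⟩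
    let d' : SFAux.E N := ⟨_, SFAux.sinv_mem h2e h2i⟩
    have hd : M.det * d = 1 := Subtype.ext
      ((congrArg (· * _) hMd.symm).trans (SFAux.mul_sinv h1e h1i))
    have hd' : M'.det * d' = 1 := Subtype.ext
      ((congrArg (· * _) hMd'.symm).trans (SFAux.mul_sinv h2e h2i))
    have hRd : M'.det * R'.det = 1 := by rw [← Matrix.det_mul, hR', Matrix.det_one]
    have hs : sdetO N (m+1) θ = ((S.det * d : SFAux.E N) : SF N) := by
      unfold sdetO; rw [hSd]; rfl
    have hs' : sdetOchk N (m+1) θ = ((S'.det * d' : SFAux.E N) : SF N) := by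
      unfold sdetOchk; rw [hSd']; rfl
    have hse : (sdetOchk N (m+1) θ).IsEven := by rw [hs']; exact (S'.det * d').2
    have hsi : (sdetOchk N (m+1) θ).Invertible := fun x t => by
      unfold sdetOchk
      rw [SFAux.mul_c0]
      refine (h4i x t).mul ?_
      exact (h2i x t).ringInverse
    let e : SFAux.E N := ⟨_, SFAux.sinv_mem hse hsi⟩
    have he : S'.det * d' * e = 1 := Subtype.ext
      ((congrArg (· * _) hs'.symm).trans (SFAux.mul_sinv hse hsi))
    have hfin : cE (Fin.last m) = -(S.det * d * e) := by
      have hRd2 : R'.det = d' := by linear_combination R'.det * hd'.symm + d' * hRd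
      rw [hRd2] at key
      linear_combination (-cE (Fin.last m)) * he + (S'.det * d' * e * (-cE (Fin.last m))) * hd - d * e * key
    have := congrArg Subtype.val hfin
    rw [hs]
    exact this
  · have key := SFAux.core2 (W0O N (m+1) θ) (W1O N (m+1) θ) (DmatSF (Wtil0 N (m+1) θ)) M R hR b c
      (W0OHat N (m+1) θ) (W1OHat N (m+1) θ)
      (fun i j => by
        have : i.1 ≠ m + 1 := by omega
        simp [W0OHat, W0O, this])
      (fun i j => by
        have : i.1 ≠ m + 1 := by omega
        simp [W1OHat, W1O, this])
      (by
        funext j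
        have h := hker2 (2 * j.1) (by omega)
        rw [← SFAux.Dpow_odd] at h
        simp only [W0OHat, Matrix.of_apply, Fin.val_last, if_true]
        exact h)
      (by
        rw [← hM]
        funext j
        have h := hker2 (2 * j.1 + 1) (by omega)
        rw [← SFAux.Dpow_odd] at h
        simp only [W1OHat, Matrix.of_apply, Fin.val_last, if_true]
        exact h)
      S (by rw [← hSe, hS])
    rw [hSh, key, ← hSd, neg_mul, neg_neg, mul_assoc, SFAux.mul_sinv h3e h3i, mul_one]
    rfl

end SFAux

/-- in the odd case `n = 2k+1`, `a_{2k−1} = −(sdet 𝒲)(sdet 𝒲̌)⁻¹`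
and `a_{2k} = −det(Ŵ⁰−Ŵ¹(DW̃¹)⁻¹DW̃⁰)·det(W⁰−W¹(DW̃¹)⁻¹DW̃⁰)⁻¹`. -/
theorem statement_10 {N : ℕ} (hN : 1 ≤ N) (k : ℕ) (hk : 1 ≤ k) (θ : ℕ → SF N)
    (hθs : ∀ j < 2*k+1, (θ j).Smooth) (hθp : ∀ j < 2*k+1, parityAt (θ j) j)
    (a : Fin (2*k+1) → SF N) (hap : ∀ i : Fin (2*k+1), parityAt (a i) (i.1 + 1))
    (has : ∀ i : Fin (2*k+1), (a i).Smooth)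
    (hker : ∀ j < 2*k+1,
      Dpow (2*k+1) (θ j) + ∑ i : Fin (2*k+1), a i * Dpow i.1 (θ j) = 0)
    (h1e : (detSF (DmatSF (Wtil1 N k θ))).IsEven)
    (h1i : (detSF (DmatSF (Wtil1 N k θ))).Invertible)
    (h2e : (detSF (DmatSF (Wchk1 N k θ))).IsEven)
    (h2i : (detSF (DmatSF (Wchk1 N k θ))).Invertible)
    (h3e : (detSF (SchurO N k θ)).IsEven)
    (h3i : (detSF (SchurO N k θ)).Invertible)
    (h4e : (detSF (SchurOchk N k θ)).IsEven)
    (h4i : (detSF (SchurOchk N k θ)).Invertible) :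
    a ⟨2*k-1, by omega⟩ = -(sdetO N k θ * (sdetOchk N k θ).sinv) ∧
    a ⟨2*k, by omega⟩ = -(detSF (SchurOHat N k θ) * (detSF (SchurO N k θ)).sinv) := by
  exact SFAux.main_aux hN k hk θ hθs hθp a hap has hker h1e h1i h2e h2i h3e h3i h4e h4i _ _
end
end

section
/- Let the pair (α,u) of an odd superfield α and an even superfield u solve the MRSKdV system, and for j = 0, …, 2k−1 let θ_j, of parity (−1)^j, solve the linear system associated with (α,u) at λ = λ_j ∈ ℝ. Assume the iterated Darboux steps are defined: with θ_j[0] = θ_j, δ_m = −(Dθ_m[m])(θ_m[m])⁻¹ and θ_j[m+1] = Dθ_j[m] + δ_m θ_j[m], each even superfield θ_m[m] (m = 0, …, 2k−1) is invertible; assume also that det DW^{(1)}, det(W^{(0)} − W^{(1)}(DW^{(1)})⁻¹DW^{(0)}) and sdet 𝒲 are invertible. Then the pair (α̂, û) defined by α̂ = α − 2∂((D sdet 𝒲)(sdet 𝒲)⁻¹) (equivalently α̂ = α − 2D³ ln sdet 𝒲) and û = u + 2∂((sdet 𝒲̂)(sdet 𝒲)⁻¹) + (α + α̂)(D sdet 𝒲)(sdet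 𝒲)⁻¹, where 𝒲̂ = [[Ŵ^{(0)}, Ŵ^{(1)}], [DW^{(0)}, DW^{(1)}]] and Ŵ^{(i)} is W^{(i)} with its last row replaced by ∂^k θ^{(i)}, again solves the MRSKdV system. -/
noncomputable section
open scoped BigOperators

noncomputable section
set_option linter.unusedSimpArgs false

/-- Abstract differential superalgebra. -/
structure SDA (A : Type) [Ring A] [Algebra ℝ A] where
  σ : A →ₐ[ℝ] A
  D : A →ₗ[ℝ] A
  τ : A →ₗ[ℝ] A
  σσ : ∀ f, σ (σ f) = f
  D_mul : ∀ f g, D (f * g) = D f * g + σ f * D g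
  τ_mul : ∀ f g, τ (f * g) = τ f * g + f * τ g
  τD : ∀ f, τ (D f) = D (τ f)
  σD : ∀ f, σ (D f) = - D (σ f)
  ev : ∀ f g, σ f = f → f * g = g * f
  od : ∀ f g, σ f = -f → σ g = -g → f * g = -(g * f)
  ϑ : A
  X : A
  σϑ : σ ϑ = -ϑ
  Dϑ : D ϑ = 1
  DX : D X = ϑ

namespace SDA
variable {A : Type} [Ring A] [Algebra ℝ A] (S : SDA A)

lemma D_one : S.D 1 = 0 := by
  have h := S.D_mul 1 1
  simpa using h

lemma sq_zero {f : A} (h : S.σ f = -f) : f * f = 0 := by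
  have h1 := S.od f f h h
  have h2 : (2:ℝ) • (f * f) = 0 := by
    rw [two_smul]; nth_rewrite 1 [h1]; simp
  simpa using h2

/-- jets -/
def jet (α : A) (i : ℕ) : A := S.D^[i] α

lemma D_jet (α : A) (i : ℕ) : S.D (S.jet α i) = S.jet α (i+1) := by
  simp only [jet, Function.iterate_succ_apply']

lemma jet_zero (α : A) : S.jet α 0 = α := rfl

lemma σ_jet {α : A} {n : ℕ} (h : S.σ α = (-1:ℝ)^n • α) (i : ℕ) :
    S.σ (S.jet α i) = (-1:ℝ)^(n+i) • S.jet α i := by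
  induction i with
  | zero => simpa [jet] using h
  | succ i ih =>
    rw [← S.D_jet, S.σD, ih, map_smul, ← add_assoc, pow_succ]
    simp

lemma scomm {f g : A} {n m : ℕ} (hf : S.σ f = (-1:ℝ)^n • f) (hg : S.σ g = (-1:ℝ)^m • g) :
    f * g = (-1:ℝ)^(n*m) • (g * f) := by
  rcases Nat.even_or_odd n with hn | hn
  · rw [(hn.mul_right m).neg_one_pow, one_smul]
    rw [hn.neg_one_pow, one_smul] at hf
    exact S.ev f g hf
  rcases Nat.even_or_odd m with hm | hm
  · rw [(hm.mul_left n).neg_one_pow, one_smul]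
    rw [hm.neg_one_pow, one_smul] at hg
    exact (S.ev g f hg).symm
  · rw [(hn.mul hm).neg_one_pow]
    rw [hm.neg_one_pow, neg_smul, one_smul] at hg
    rw [hn.neg_one_pow, neg_smul, one_smul] at hf
    rw [neg_smul, one_smul]
    exact S.od f g hf hg

lemma scomm' {f g : A} {n m : ℕ} (hf : S.σ f = (-1:ℝ)^n • f) (hg : S.σ g = (-1:ℝ)^m • g) (z : A) :
    f * (g * z) = (-1:ℝ)^(n*m) • (g * (f * z)) := by
  rw [← mul_assoc, S.scomm hf hg, smul_mul_assoc, mul_assoc]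

section step
variable {α δ : A} (hα : S.σ α = -α) (hδ : S.σ δ = -δ)
include hα
lemma odd1 : S.σ α = (-1:ℝ)^1 • α := by rw [hα]; simp
lemma σjo (i : ℕ) : S.σ (S.jet α i) = (-1:ℝ)^(1+i) • S.jet α i := S.σ_jet (S.odd1 hα) i
lemma jj (i j : ℕ) (_h : j < i) : S.jet α i * S.jet α j =
    (-1:ℝ)^((1+i)*(1+j)) • (S.jet α j * S.jet α i) := S.scomm (S.σjo hα i) (S.σjo hα j)
lemma jj' (i j : ℕ) (_h : j < i) (z : A) : S.jet α i * (S.jet α j * z) =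
    (-1:ℝ)^((1+i)*(1+j)) • (S.jet α j * (S.jet α i * z)) := S.scomm' (S.σjo hα i) (S.σjo hα j) z
lemma js (i : ℕ) (h : i % 2 = 0) : S.jet α i * S.jet α i = 0 := by
  apply S.sq_zero
  rw [S.σjo hα, Odd.neg_one_pow]
  · simp
  · rw [add_comm]; exact (Nat.even_iff.2 h).add_one
lemma js' (i : ℕ) (h : i % 2 = 0) (z : A) : S.jet α i * (S.jet α i * z) = 0 := by
  rw [← mul_assoc, S.js hα i h, zero_mul]
include hδ
lemma jk (i j : ℕ) : S.jet δ i * S.jet α j =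
    (-1:ℝ)^((1+i)*(1+j)) • (S.jet α j * S.jet δ i) := S.scomm (S.σjo hδ i) (S.σjo hα j)
lemma jk' (i j : ℕ) (z : A) : S.jet δ i * (S.jet α j * z) =
    (-1:ℝ)^((1+i)*(1+j)) • (S.jet α j * (S.jet δ i * z)) := S.scomm' (S.σjo hδ i) (S.σjo hα j) z
end step

/-- The Lax operator. -/
def Lo (α u ψ : A) : A := S.jet ψ 4 + α * S.jet ψ 1 + u * ψ
/-- The evolution operator. -/
def Bo (α u ψ : A) : A := S.jet ψ 6 + (3/2:ℝ) • (α * S.jet ψ 3) + (3/2:ℝ) • (u * S.jet ψ 2)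
  + (3/4:ℝ) • (S.jet α 2 * S.jet ψ 1) + (3/4:ℝ) • (S.jet u 2 * ψ)
/-- Darboux step. -/
def To (δ ψ : A) : A := S.D ψ + δ * ψ
/-- new potential -/
def aH (α δ : A) : A := - α - (2:ℝ) • S.jet δ 2
/-- new potential -/
def uH (α u δ : A) : A := u + S.jet α 1 + (2:ℝ) • (δ * (α + S.jet δ 2))

lemma jet_add (f g : A) (i : ℕ) : S.jet (f+g) i = S.jet f i + S.jet g i := by
  induction i with
  | zero => rfl
  | succ i ih => rw [← D_jet, ih, map_add, D_jet, D_jet]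
lemma jet_sub (f g : A) (i : ℕ) : S.jet (f-g) i = S.jet f i - S.jet g i := by
  induction i with
  | zero => rfl
  | succ i ih => rw [← D_jet, ih, map_sub, D_jet, D_jet]
lemma jet_neg (f : A) (i : ℕ) : S.jet (-f) i = - S.jet f i := by
  induction i with
  | zero => rfl
  | succ i ih => rw [← D_jet, ih, map_neg, D_jet]
lemma jet_smul (c : ℝ) (f : A) (i : ℕ) : S.jet (c • f) i = c • S.jet f i := by
  induction i with
  | zero => rfl
  | succ i ih => rw [← D_jet, ih, map_smul, D_jet]
lemma jet_jet (f : A) (i j : ℕ) : S.jet (S.jet f i) j = S.jet f (j+i) := by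
  simp only [jet, Function.iterate_add_apply]
lemma jet_succ (f : A) (i : ℕ) : S.jet f (i+1) = S.jet (S.D f) i := by
  simp only [jet, Function.iterate_succ_apply]
lemma jet2_mul (f g : A) : S.jet (f*g) 2 = S.jet f 2 * g + f * S.jet g 2 := by
  simp [jet, D_mul, S.σD, S.σσ]; 

lemma jet_one (i : ℕ) : S.jet 1 (i+1) = 0 := by
  rw [jet_succ, D_one]
  induction i with
  | zero => rfl
  | succ i ih => rw [← D_jet, ih, map_zero]

lemma jet_zero' (i : ℕ) : S.jet 0 i = 0 := by
  simpa using S.jet_smul 0 0 i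
lemma D_eq (f : A) : S.D f = S.jet f 1 := rfl
lemma jm1 (f g : A) : S.jet (f*g) 1 = S.jet f 1 * g + S.σ f * S.jet g 1 := S.D_mul f g
lemma jm (f g : A) (n : ℕ) : S.jet (f*g) (n+2) = S.jet (S.jet f 2 * g) n + S.jet (f * S.jet g 2) n := by
  rw [← jet_add, ← jet2_mul, jet_jet]
lemma jm3 (f g : A) : S.jet (f*g) 3 = S.jet (S.jet f 2 * g) 1 + S.jet (f * S.jet g 2) 1 := S.jm f g 1
lemma jm4 (f g : A) : S.jet (f*g) 4 = S.jet (S.jet f 2 * g) 2 + S.jet (f * S.jet g 2) 2 := S.jm f g 2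
lemma jm5 (f g : A) : S.jet (f*g) 5 = S.jet (S.jet f 2 * g) 3 + S.jet (f * S.jet g 2) 3 := S.jm f g 3
lemma jm6 (f g : A) : S.jet (f*g) 6 = S.jet (S.jet f 2 * g) 4 + S.jet (f * S.jet g 2) 4 := S.jm f g 4
lemma jone (i : ℕ) (h : 0 < i) : S.jet (1:A) i = 0 := by
  obtain ⟨n, rfl⟩ : ∃ n, i = n + 1 := ⟨i-1, by omega⟩
  rw [jet_one]

set_option maxHeartbeats 4000000 in
lemma L_inter {α δ : A} (hα : S.σ α = -α) (hδ : S.σ δ = -δ) (l : ℝ) (u : A)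
    (hu : u = l • (1:A) + S.jet δ 3 - S.jet δ 1 * S.jet δ 1 + α * δ) (ψ : A) :
    S.To δ (S.Lo α u ψ) = S.Lo (S.aH α δ) (S.uH α u δ) (S.To δ ψ) := by
  subst hu
  rw [← S.jet_zero α, ← S.jet_zero δ, ← S.jet_zero ψ]
  simp (discharger := omega) only [To, Lo, aH, uH, D_eq, jet_jet, jet_add, jet_sub, jet_neg, jet_smul, jm1, jet2_mul, jm3, jm4,
    jm5, jm6, jone, smul_zero, add_zero, zero_add, zero_sub, sub_zero, map_add, map_sub, map_neg, map_smul, map_one, map_mul, S.σjo hα, S.σjo hδ, Nat.reduceAdd,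
    mul_add, add_mul, mul_sub, sub_mul, smul_add, smul_sub, smul_smul, mul_smul_comm, smul_mul_assoc, mul_assoc, one_mul,
    mul_one, neg_mul, mul_neg, mul_zero, zero_mul]
  simp (discharger := omega) only [S.jj hα, S.jj hδ, S.jj' hα, S.jj' hδ, S.jk hα hδ, S.jk' hα hδ, S.js hα, S.js hδ, S.js' hα, S.js' hδ,
    mul_smul_comm, smul_smul, mul_zero, smul_zero]
  module

set_option maxHeartbeats 4000000 in
lemma B_inter {α δ : A} (hα : S.σ α = -α) (hδ : S.σ δ = -δ) (l : ℝ) (u : A)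
    (hu : u = l • (1:A) + S.jet δ 3 - S.jet δ 1 * S.jet δ 1 + α * δ) (ψ : A) :
    S.Bo (S.aH α δ) (S.uH α u δ) (S.To δ ψ) - S.To δ (S.Bo α u ψ) =
    (S.Bo (S.aH α δ) (S.uH α u δ) δ - S.To δ ((3/4:ℝ) • (S.jet u 2))) * ψ := by
  subst hu
  rw [← S.jet_zero α, ← S.jet_zero δ, ← S.jet_zero ψ]
  simp (discharger := omega) only [To, Bo, aH, uH, D_eq, jet_jet, jet_add, jet_sub, jet_neg, jet_smul, jm1, jet2_mul, jm3, jm4,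
    jm5, jm6, jone, smul_zero, add_zero, zero_add, zero_sub, sub_zero, map_add, map_sub, map_neg, map_smul, map_one, map_mul, S.σjo hα, S.σjo hδ, Nat.reduceAdd,
    mul_add, add_mul, mul_sub, sub_mul, smul_add, smul_sub, smul_smul, mul_smul_comm, smul_mul_assoc, mul_assoc, one_mul,
    mul_one, neg_mul, mul_neg, mul_zero, zero_mul]
  simp (discharger := omega) only [S.jj hα, S.jj hδ, S.jj' hα, S.jj' hδ, S.jk hα hδ, S.jk' hα hδ, S.js hα, S.js hδ, S.js' hα, S.js' hδ,
    mul_smul_comm, smul_smul, mul_zero, smul_zero]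
  module

end SDA
end

noncomputable section
set_option linter.unusedSimpArgs false
namespace SDA
variable {A : Type} [Ring A] [Algebra ℝ A] (S : SDA A)

/-- rhs of first equation -/
def R1 (α u : A) : A := (1/4:ℝ) • S.jet (S.jet α 4 + (3:ℝ) • (α * S.jet α 1) + (6:ℝ) • (α * u)) 2
/-- rhs of second equation -/
def R2 (α u : A) : A := (1/4:ℝ) • S.jet (S.jet u 4 + (3:ℝ) • (u * u) + (3:ℝ) • (α * S.jet u 1)) 2

section
variable {α u : A} (hα : S.σ α = -α) (hu : S.σ u = u)
include hu
lemma σje (i : ℕ) : S.σ (S.jet u i) = (-1:ℝ)^(0+i) • S.jet u i := S.σ_jet (by simp [hu]) i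
lemma ejj (i j : ℕ) (_h : j < i) : S.jet u i * S.jet u j =
    (-1:ℝ)^((0+i)*(0+j)) • (S.jet u j * S.jet u i) := S.scomm (S.σje hu i) (S.σje hu j)
lemma ejj' (i j : ℕ) (_h : j < i) (z : A) : S.jet u i * (S.jet u j * z) =
    (-1:ℝ)^((0+i)*(0+j)) • (S.jet u j * (S.jet u i * z)) := S.scomm' (S.σje hu i) (S.σje hu j) z
include hα
lemma ejk (i j : ℕ) : S.jet u i * S.jet α j =
    (-1:ℝ)^((0+i)*(1+j)) • (S.jet α j * S.jet u i) := S.scomm (S.σje hu i) (S.σjo hα j)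
lemma ejk' (i j : ℕ) (z : A) : S.jet u i * (S.jet α j * z) =
    (-1:ℝ)^((0+i)*(1+j)) • (S.jet α j * (S.jet u i * z)) := S.scomm' (S.σje hu i) (S.σjo hα j) z
end

set_option maxHeartbeats 4000000 in
lemma lax_aux {α u : A} (hα : S.σ α = -α) (hu : S.σ u = u) (ψ : A) :
    S.Bo α u (S.Lo α u ψ) - S.Lo α u (S.Bo α u ψ) = S.R1 α u * S.D ψ + S.R2 α u * ψ := by
  rw [← S.jet_zero α, ← S.jet_zero u, ← S.jet_zero ψ]
  simp (discharger := omega) only [Lo, Bo, R1, R2, D_eq, jet_jet, jet_add, jet_sub, jet_neg, jet_smul, jm1, jet2_mul, jm3, jm4,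
    jm5, jm6, map_add, map_sub, map_neg, map_smul, map_one, map_mul, S.σjo hα, S.σje hu, Nat.reduceAdd,
    mul_add, add_mul, mul_sub, sub_mul, smul_add, smul_sub, smul_smul, mul_smul_comm, smul_mul_assoc, mul_assoc, one_mul,
    mul_one, neg_mul, mul_neg, mul_zero, zero_mul]
  simp (discharger := omega) only [S.jj hα, S.ejj hu, S.jj' hα, S.ejj' hu, S.ejk hα hu, S.ejk' hα hu, S.js hα, S.js' hα,
    mul_smul_comm, smul_smul, mul_zero, smul_zero]
  module

lemma τ_jet (f : A) (i : ℕ) : S.τ (S.jet f i) = S.jet (S.τ f) i := by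
  induction i with
  | zero => rfl
  | succ i ih => rw [← D_jet, S.τD, ih, D_jet]

lemma lax {α u : A} (hα : S.σ α = -α) (hu : S.σ u = u) (ψ : A) :
    (S.τ (S.Lo α u ψ) - S.Bo α u (S.Lo α u ψ)) - S.Lo α u (S.τ ψ - S.Bo α u ψ) =
     (S.τ α - S.R1 α u) * S.D ψ + (S.τ u - S.R2 α u) * ψ := by
  have h := S.lax_aux hα hu ψ
  have h2 : S.Lo α u (S.τ ψ - S.Bo α u ψ) = S.Lo α u (S.τ ψ) - S.Lo α u (S.Bo α u ψ) := by
    simp only [Lo, jet_sub, mul_sub]; abel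
  have h3 : S.τ (S.Lo α u ψ) = S.Lo α u (S.τ ψ) + S.τ α * S.D ψ + S.τ u * ψ := by
    simp only [Lo, map_add, S.τ_mul, τ_jet, D_eq]; abel
  rw [h2, h3, sub_mul, sub_mul]
  have h4 : S.Bo α u (S.Lo α u ψ) = S.Lo α u (S.Bo α u ψ) + (S.R1 α u * S.D ψ + S.R2 α u * ψ) := by
    rw [← h]; abel
  rw [h4]; abel

lemma uniq {p q δ : A} (hδ : S.σ δ = -δ) (h : ∀ ψ, p * S.D (S.To δ ψ) + q * S.To δ ψ = 0) :
    p = 0 ∧ q = 0 := by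
  have h0 := h 1
  have h1 := h S.ϑ
  have h2 := h S.X
  simp only [To, S.D_one, mul_one, zero_add] at h0
  simp only [To, S.Dϑ, map_add, S.D_one, S.D_mul, hδ, mul_one, zero_add, mul_add] at h1
  simp only [To, S.DX, S.Dϑ, map_add, S.D_one, S.D_mul, hδ, mul_one, zero_add, mul_add] at h2
  have e1 : p * S.D δ * S.ϑ + q * δ * S.ϑ = 0 := by rw [← add_mul, h0, zero_mul]
  have e2 : p * S.D δ * S.X + q * δ * S.X = 0 := by rw [← add_mul, h0, zero_mul]
  have f1 : q - p * δ = 0 := by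
    have this : p * (S.D δ * S.ϑ) + q * (δ * S.ϑ) = 0 := by rw [← e1]; noncomm_ring
    have e := congrArg₂ (· - ·) h1 this
    simp only [sub_zero] at e
    rw [← e]; noncomm_ring
  have f2 : (q - p * δ) * S.ϑ = 0 := by rw [f1, zero_mul]
  have f3 : p = 0 := by
    have a1 : p * (S.D δ * S.X) + q * (δ * S.X) = 0 := by rw [← e2]; noncomm_ring
    have a2 : p * (-δ * S.ϑ) + q * S.ϑ = 0 := by rw [← f2]; noncomm_ring
    have := h2
    calc p = (p + (p * (S.D δ * S.X) + p * (-δ * S.ϑ)) + (q * S.ϑ + q * (δ * S.X)))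
           - (p * (S.D δ * S.X) + q * (δ * S.X)) - (p * (-δ * S.ϑ) + q * S.ϑ) := by abel
      _ = 0 := by rw [h2, a1, a2]; simp
  refine ⟨f3, ?_⟩
  rw [f3] at f1
  simpa using f1

/-- Solves MRSKdV. -/
def Sol (α u : A) : Prop := S.τ α = S.R1 α u ∧ S.τ u = S.R2 α u

/-- Solves the linear system. -/
def Lin (α u : A) (l : ℝ) (ψ : A) : Prop := S.Lo α u ψ = l • ψ ∧ S.τ ψ = S.Bo α u ψ

lemma To_sub (δ f g : A) : S.To δ (f - g) = S.To δ f - S.To δ g := by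
  simp only [To, map_sub, mul_sub]; abel

/-- One Darboux step. -/
theorem step {α u θ ti : A} {l : ℝ} (hα : S.σ α = -α) (hu : S.σ u = u) (hθ : S.σ θ = θ)
    (hti : θ * ti = 1) (hti' : ti * θ = 1) (hL : S.Lin α u l θ) (hS : S.Sol α u)
    (δ : A) (hδd : δ = -(S.D θ * ti)) :
    S.σ δ = -δ ∧ S.To δ θ = 0 ∧ S.σ (S.aH α δ) = - S.aH α δ ∧ S.σ (S.uH α u δ) = S.uH α u δ ∧
    S.Sol (S.aH α δ) (S.uH α u δ) ∧
    (∀ ψ, S.To δ (S.Lo α u ψ) = S.Lo (S.aH α δ) (S.uH α u δ) (S.To δ ψ)) ∧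
    (∀ m ψ, S.Lin α u m ψ → S.Lin (S.aH α δ) (S.uH α u δ) m (S.To δ ψ)) := by
  have hσti : S.σ ti = ti := by
    have h : S.σ θ * S.σ ti = 1 := by rw [← map_mul, hti, map_one]
    rw [hθ] at h
    calc S.σ ti = (ti * θ) * S.σ ti := by rw [hti', one_mul]
      _ = ti := by rw [mul_assoc, h, mul_one]
  have hδ : S.σ δ = -δ := by
    rw [hδd, map_neg, map_mul, hσti, S.σD, hθ, neg_mul]
  have hDθ : S.D θ = -(δ * θ) := by
    rw [hδd, neg_mul, neg_neg, mul_assoc, hti', mul_one]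
  have hT : S.To δ θ = 0 := by rw [To, hDθ]; simp
  have canc : ∀ x : A, x * θ = 0 → x = 0 := fun x h => by
    calc x = (x * θ) * ti := by rw [mul_assoc, hti, mul_one]
      _ = 0 := by rw [h, zero_mul]
  have hD2 : S.jet θ 2 = -(S.D δ * θ) := by
    show S.D (S.D θ) = _
    rw [hDθ, map_neg, S.D_mul, hDθ, hδ]
    have := S.sq_zero hδ
    rw [neg_mul, mul_neg, neg_neg, ← mul_assoc, this]; simp
  have hD4 : S.jet θ 4 = -(S.jet δ 3 * θ) + S.jet δ 1 * S.jet δ 1 * θ := by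
    have : S.jet θ 4 = S.jet (S.jet θ 2) 2 := by rw [jet_jet]
    rw [this, hD2, jet_neg, jet2_mul, hD2, D_eq, jet_jet]
    simp only [Nat.reduceAdd, mul_neg, neg_add, neg_neg, mul_assoc]
  have hueq : u = l • (1:A) + S.jet δ 3 - S.jet δ 1 * S.jet δ 1 + α * δ := by
    rw [← sub_eq_zero]
    apply canc
    have h1 := hL.1
    rw [Lo, hD4, ← S.D_eq θ, hDθ] at h1
    simp only [sub_mul, add_mul, smul_mul_assoc, one_mul, ← h1, mul_neg, mul_assoc]
    abel
  have hLi := S.L_inter hα hδ l u hueq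
  have hBi := S.B_inter hα hδ l u hueq
  set a' := S.aH α δ with ha'
  set u' := S.uH α u δ with hu'
  set c := S.Bo a' u' δ - S.To δ ((3/4:ℝ) • (S.jet u 2)) with hc
  have hτT : ∀ ψ, S.τ (S.To δ ψ) = S.To δ (S.τ ψ) + S.τ δ * ψ := fun ψ => by
    simp only [To, map_add, S.τ_mul, S.τD]; abel
  have hcδ : S.τ δ = c := by
    rw [← sub_eq_zero]
    apply canc
    have h1 := hBi θ
    have h2 := hτT θ
    rw [hT, ← hL.2] at h1
    rw [hT, map_zero] at h2
    have h3 : S.Bo a' u' 0 = 0 := by simp [Bo, jet_zero']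
    rw [h3] at h1
    rw [sub_mul, ← h1, zero_sub, sub_neg_eq_add, add_comm, ← h2]
  have hint : ∀ ψ, S.τ (S.To δ ψ) - S.Bo a' u' (S.To δ ψ) = S.To δ (S.τ ψ - S.Bo α u ψ) := fun ψ => by
    rw [hτT, To_sub, hcδ, ← hBi ψ]; abel
  have ho2 : S.σ (S.jet δ 2) = - S.jet δ 2 := by
    show S.σ (S.D (S.D δ)) = - S.D (S.D δ)
    rw [S.σD, S.σD, hδ]; simp
  have ho' : S.σ a' = -a' := by
    rw [ha', aH, map_sub, map_neg, map_smul, hα, ho2]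
    module
  have hu'e : S.σ u' = u' := by
    rw [hu', uH, map_add, map_add, map_smul, map_mul, map_add, ho2, hα, hδ, hu]
    have : S.σ (S.jet α 1) = S.jet α 1 := by
      show S.σ (S.D α) = S.D α
      rw [S.σD, hα]; simp
    rw [this]
    congr 2
    noncomm_ring
  refine ⟨hδ, hT, ho', hu'e, ?_, hLi, ?_⟩
  · have key := S.uniq (p := S.τ a' - S.R1 a' u') (q := S.τ u' - S.R2 a' u') hδ (fun ψ => by
      rw [← S.lax ho' hu'e, hint ψ, ← hLi ψ, hint, ← hLi, ← To_sub, S.lax hα hu, hS.1, hS.2]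
      simp [To])
    exact ⟨sub_eq_zero.1 key.1, sub_eq_zero.1 key.2⟩
  · intro m ψ hψ
    refine ⟨?_, ?_⟩
    · rw [← hLi, hψ.1]; simp [To]
    · rw [← sub_eq_zero, hint, hψ.2]; simp [To]

end SDA
end

noncomputable section
namespace SDA
variable {A : Type} [Ring A] [Algebra ℝ A] (S : SDA A)

/-- log derivative -/
def dl (f : A) : A := -(S.D f * Ring.inverse f)

/-- iterated Darboux -/
def dI (θ : ℕ → A) : ℕ → ℕ → A
  | 0, j => θ j
  | m + 1, j => S.To (S.dl (dI θ m m)) (dI θ m j)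

/-- new coefficients -/
def eN (δ : A) (e : ℕ → A) : ℕ → A
  | 0 => 1
  | i + 1 => S.D (e i) + δ * e i + S.σ (e (i+1))

theorem chain {α u : A} (K : ℕ) (θ : ℕ → A) (lam : ℕ → ℝ)
    (hα : S.σ α = -α) (hu : S.σ u = u) (hS : S.Sol α u)
    (hθ : ∀ j < K, S.σ (θ j) = (-1:ℝ)^j • θ j)
    (hL : ∀ j < K, S.Lin α u (lam j) (θ j))
    (hU : ∀ m < K, IsUnit (S.dI θ m m)) :
    ∀ n ≤ K, ∃ (αn un : A) (e : ℕ → A), S.σ αn = -αn ∧ S.σ un = un ∧ S.Sol αn un ∧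
      (∀ j < K, S.Lin αn un (lam j) (S.dI θ n j)) ∧
      (∀ j < K, S.σ (S.dI θ n j) = (-1:ℝ)^(n+j) • S.dI θ n j) ∧
      (∀ j < n, S.dI θ n j = 0) ∧ e 0 = 1 ∧ (∀ i, n < i → e i = 0) ∧
      (∀ i, S.σ (e i) = (-1:ℝ)^i • e i) ∧
      (∀ j, S.dI θ n j = ∑ p ∈ Finset.HasAntidiagonal.antidiagonal n, e p.1 * S.jet (θ j) p.2) ∧
      αn = (-1:ℝ)^n • α - (2:ℝ) • S.jet (e 1) 2 ∧
      un = u + ((1 - (-1:ℝ)^n)/2) • S.jet α 1 - (2:ℝ) • S.jet (e 2) 2 + (αn + (-1:ℝ)^n • α) * e 1 := by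
  intro n
  induction n with
  | zero =>
    intro _
    refine ⟨α, u, fun i => if i = 0 then 1 else 0, hα, hu, hS, hL, ?_, by simp, by simp, ?_, ?_, ?_, ?_, ?_⟩
    · simpa [dI] using hθ
    · intro i hi; simp [hi.ne']
    · intro i; by_cases h : i = 0 <;> simp [h]
    · intro j; simp [dI, jet]
    · simp [jet_zero']
    · simp [jet_zero']
  | succ n ih =>
    intro hn
    obtain ⟨αn, un, e, ho, he, hSn, hLn, hσn, h0, e0, eb, eσ, hsum, hαn, hun⟩ := ih (by omega)
    have hun1 := hU n (by omega)
    have hev : S.σ (S.dI θ n n) = S.dI θ n n := by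
      have := hσn n (by omega)
      rwa [(Even.add_self n).neg_one_pow, one_smul] at this
    obtain ⟨hδ, hT, ho', he', hS', -, hL'⟩ := S.step ho he hev (Ring.mul_inverse_cancel _ hun1)
      (Ring.inverse_mul_cancel _ hun1) (hLn n (by omega)) hSn (S.dl (S.dI θ n n)) rfl
    set δ := S.dl (S.dI θ n n) with hδd
    have hd : ∀ j, S.dI θ (n+1) j = S.To δ (S.dI θ n j) := fun j => rfl
    have he1 : S.σ (e 1) = - e 1 := by simpa using eσ 1
    have he2 : S.σ (e 2) = e 2 := by simpa using eσ 2
    have E1 : S.eN δ e 1 = δ - e 1 := by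
      simp only [eN, e0, S.D_one, he1, mul_one]; abel
    have E2 : S.eN δ e 2 = S.D (e 1) + δ * e 1 + e 2 := by
      simp only [eN, he2]
    have par : ∀ (m : ℕ) (f : A), S.σ f = (-1:ℝ)^m • f → S.σ (S.To δ f) = (-1:ℝ)^(m+1) • S.To δ f := by
      intro m f hf
      rw [To, map_add, S.σD, map_mul, hf, hδ, map_smul, pow_succ]
      simp
    refine ⟨_, _, S.eN δ e, ho', he', hS', fun j hj => hL' _ _ (hLn j hj), ?_, ?_, rfl, ?_, ?_, ?_, ?_, ?_⟩
    · intro j hj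
      rw [hd, par _ _ (hσn j hj)]
      congr 2; omega
    · intro j hj
      rw [hd]
      rcases Nat.lt_succ_iff_lt_or_eq.1 hj with h | h
      · rw [h0 j h]; simp [To]
      · rw [h]; exact hT
    · intro i hi
      obtain ⟨i, rfl⟩ : ∃ m, i = m + 1 := ⟨i - 1, by omega⟩
      simp only [eN, eb i (by omega), eb (i+1) (by omega)]
      simp
    · intro i
      rcases i with _ | i
      · simp [eN]
      · have := par i (e i) (eσ i)
        rw [To] at this
        simp only [eN, map_add] at this ⊢
        rw [this, S.σσ, eσ (i+1), smul_add _ _ ((-1:ℝ)^(i+1) • e (i+1)), smul_smul]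
        congr 1
        rw [← pow_add, Even.neg_one_pow ⟨i+1, rfl⟩, one_smul]
    · intro j
      rw [hd, hsum]
      have t1 : S.To δ (∑ p ∈ Finset.HasAntidiagonal.antidiagonal n, e p.1 * S.jet (θ j) p.2) =
          ∑ p ∈ Finset.HasAntidiagonal.antidiagonal n, (S.D (e p.1) + δ * e p.1) * S.jet (θ j) p.2 +
          ∑ p ∈ Finset.HasAntidiagonal.antidiagonal n, S.σ (e p.1) * S.jet (θ j) (p.2+1) := by
        rw [To, map_sum, Finset.mul_sum, ← Finset.sum_add_distrib, ← Finset.sum_add_distrib]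
        refine Finset.sum_congr rfl fun p _ => ?_
        rw [S.D_mul, S.D_jet, add_mul, mul_assoc]; abel
      have t2 := Finset.Nat.sum_antidiagonal_succ (n := n) (f := fun p => S.σ (e p.1) * S.jet (θ j) p.2)
      have t3 := Finset.Nat.sum_antidiagonal_succ' (n := n) (f := fun p => S.σ (e p.1) * S.jet (θ j) p.2)
      simp only [e0, eb (n+1) (by omega), map_zero, zero_mul, zero_add, map_one, one_mul] at t2 t3
      rw [t1, ← t3, t2, Finset.Nat.sum_antidiagonal_succ]
      simp only [eN, one_mul, add_mul, Finset.sum_add_distrib]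
      abel
    · rw [E1, jet_sub, aH, hαn, pow_succ]
      module
    · have ha2 : S.σ (S.jet (e 1) 2) = - S.jet (e 1) 2 := by
        show S.σ (S.D (S.D _)) = - S.D (S.D _)
        rw [S.σD, S.σD, he1]; simp
      have hd2 : S.σ (S.jet δ 2) = - S.jet δ 2 := by
        show S.σ (S.D (S.D _)) = - S.D (S.D _)
        rw [S.σD, S.σD, hδ]; simp
      have c1 := S.od δ α hδ hα
      have c2 := S.od δ (S.jet (e 1) 2) hδ ha2
      have c3 := S.od δ (S.jet δ 2) hδ hd2
      rw [E1, E2, uH, aH, hun, hαn, pow_succ]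
      simp only [jet_add, jet_sub, jet_smul, jet2_mul, D_eq, jet_jet, mul_add, mul_sub, add_mul, sub_mul,
        mul_smul_comm, smul_mul_assoc, neg_mul, c1, c2, c3, Nat.reduceAdd]
      module

end SDA
end

noncomputable section

section detder
variable {R N : Type} [CommRing R] [AddCommGroup N] [Module R N] (d : R →+ N)
  (hd : ∀ a b, d (a * b) = a • d b + b • d a)
include hd

lemma der_prod {ι : Type} [DecidableEq ι] (s : Finset ι) (f : ι → R) :
    d (∏ i ∈ s, f i) = ∑ i ∈ s, (∏ j ∈ s.erase i, f j) • d (f i) := by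
  have d1 : d 1 = 0 := by simpa using hd 1 1
  induction s using Finset.induction_on with
  | empty => simp [d1]
  | insert a s ha ih =>
    rw [Finset.prod_insert ha, hd, ih, Finset.sum_insert ha, Finset.erase_insert ha, add_comm, Finset.smul_sum]
    congr 1
    refine Finset.sum_congr rfl fun i hi => ?_
    have hne : a ≠ i := fun h => ha (h ▸ hi)
    rw [Finset.erase_insert_of_ne hne, Finset.prod_insert (by simp [ha]), smul_smul]

lemma der_det {n : ℕ} (M : Matrix (Fin n) (Fin n) R) :
    d M.det = ∑ i, ∑ j, M.adjugate i j • d (M j i) := by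
  have hadj : ∀ i j, M.adjugate i j = (M.updateCol i (Pi.single j 1)).det := by
    intro i j
    rw [← Matrix.cramer_apply, Matrix.cramer_eq_adjugate_mulVec, Matrix.mulVec_single_one]; rfl
  have hdet : ∀ i j, M.adjugate i j = ∑ p : Equiv.Perm (Fin n), ((Equiv.Perm.sign p : ℤ) : R) *
      ((if p i = j then 1 else 0) * ∏ l ∈ Finset.univ.erase i, M (p l) l) := by
    intro i j
    rw [hadj, Matrix.det_apply']
    refine Finset.sum_congr rfl fun p _ => ?_
    rw [← Finset.mul_prod_erase _ _ (Finset.mem_univ i)]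
    congr 2
    · simp [Pi.single_apply]
    · refine Finset.prod_congr rfl fun l hl => ?_
      rw [Matrix.updateCol_ne (Finset.ne_of_mem_erase hl)]
  have hz : ∀ (z : ℤ) (a : R), d ((z:R) * a) = (z:R) • d a := by
    intro z a
    rw [← zsmul_eq_mul, map_zsmul, Int.cast_smul_eq_zsmul]
  rw [Matrix.det_apply', map_sum]
  simp only [hz, der_prod d hd, hdet, Finset.sum_smul, Finset.smul_sum]
  rw [Finset.sum_comm]
  refine Finset.sum_congr rfl fun i _ => ?_
  rw [Finset.sum_comm]
  refine Finset.sum_congr rfl fun p _ => ?_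
  rw [Finset.sum_eq_single (p i)]
  · simp [smul_smul]
  · intro b _ hb; simp [hb.symm]
  · simp
end detder

namespace SDA
variable {A : Type} [Ring A] [Algebra ℝ A] (S : SDA A)

/-- The even subring. -/
def A0 : Subring A where
  carrier := {f | S.σ f = f}
  mul_mem' := fun ha hb => by simp only [Set.mem_ofPred_eq] at *; rw [map_mul, ha, hb]
  one_mem' := by simp
  add_mem' := fun ha hb => by simp only [Set.mem_ofPred_eq] at *; rw [map_add, ha, hb]
  zero_mem' := by simp
  neg_mem' := fun ha => by simp only [Set.mem_ofPred_eq] at *; rw [map_neg, ha]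

instance : CommRing S.A0 :=
  { (inferInstance : Ring S.A0) with
    mul_comm := fun a b => Subtype.ext (S.ev a b a.2) }

/-- coercion of matrices -/
abbrev cm {n : ℕ} (M : Matrix (Fin n) (Fin n) S.A0) : Matrix (Fin n) (Fin n) A :=
  M.map (S.A0.subtype)

/-- derivative of matrices -/
abbrev Dm {n : ℕ} (M : Matrix (Fin n) (Fin n) A) : Matrix (Fin n) (Fin n) A := M.map S.D

variable {n : ℕ}

lemma cm_mul (M M' : Matrix (Fin n) (Fin n) S.A0) : S.cm (M * M') = S.cm M * S.cm M' :=
  Matrix.map_mul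
lemma cm_one : S.cm (1 : Matrix (Fin n) (Fin n) S.A0) = 1 := by
  simp [cm]

lemma Dm_mul (M M' : Matrix (Fin n) (Fin n) A) :
    S.Dm (M * M') = S.Dm M * M' + M.map S.σ * S.Dm M' := by
  ext i j
  simp [Matrix.mul_apply, S.D_mul, Finset.sum_add_distrib]

lemma Dm_cm_mul (M : Matrix (Fin n) (Fin n) S.A0) (M' : Matrix (Fin n) (Fin n) A) :
    S.Dm (S.cm M * M') = S.Dm (S.cm M) * M' + S.cm M * S.Dm M' := by
  rw [Dm_mul]; congr 2; ext i j; exact (M i j).2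

lemma D_det (M : Matrix (Fin n) (Fin n) S.A0) :
    S.D (M.det : A) = (S.Dm (S.cm M) * S.cm M.adjugate).trace := by
  have h := der_det (R := S.A0) (N := A) ((S.D : A →+ A).comp (S.A0.subtype : S.A0 →+ A)) (by
    intro a b
    have ha : S.σ (a:A) = a := a.2
    show S.D ((a:A) * b) = (a:A) * S.D b + (b:A) * S.D a
    rw [S.D_mul, ha, S.ev b (S.D a) b.2]; abel) M
  change S.D (M.det : A) = _ at h
  rw [h, Matrix.trace, Finset.sum_comm]
  refine Finset.sum_congr rfl fun i _ => ?_
  rw [Matrix.diag_apply, Matrix.mul_apply]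
  refine Finset.sum_congr rfl fun j _ => ?_
  exact S.ev _ _ (M.adjugate j i).2

lemma trace_cm_comm (M : Matrix (Fin n) (Fin n) S.A0) (X : Matrix (Fin n) (Fin n) A) :
    (X * S.cm M).trace = (S.cm M * X).trace := by
  simp only [Matrix.trace, Matrix.diag_apply, Matrix.mul_apply]
  rw [Finset.sum_comm]
  refine Finset.sum_congr rfl fun i _ => Finset.sum_congr rfl fun j _ => ?_
  exact (S.ev _ _ (M i j).2).symm

theorem sdet_core (R Q K Y : Matrix (Fin n) (Fin n) S.A0) (P T E : Matrix (Fin n) (Fin n) A)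
    (hP : P.map S.σ = -P) (hR : S.Dm (S.cm R) = T) (hPQ : S.Dm P = S.cm Q)
    (hT : S.Dm T = S.cm K * S.cm R - E * T)
    (hQ : S.Dm (S.cm Q) = S.cm K * P - E * S.cm Q)
    (uQ : IsUnit Q.det)
    (hY : S.cm Y = S.cm R - P * S.cm Q⁻¹ * T) (q : S.A0) (hq : Q.det * q = 1) :
    S.D ((Y.det * q : S.A0) : A) = ((Y.det * q : S.A0) : A) * E.trace := by
  have hQi : S.cm Q * S.cm Q⁻¹ = 1 := by rw [← cm_mul, Matrix.mul_nonsing_inv _ uQ, cm_one]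
  have hQi' : S.cm Q⁻¹ * S.cm Q = 1 := by rw [← cm_mul, Matrix.nonsing_inv_mul _ uQ, cm_one]
  have h1 : S.Dm (S.cm Q⁻¹) = - (S.cm Q⁻¹ * S.Dm (S.cm Q) * S.cm Q⁻¹) := by
    have h := S.Dm_cm_mul Q (S.cm Q⁻¹)
    have h0 : S.Dm (1 : Matrix (Fin n) (Fin n) A) = 0 := by
      ext i j
      by_cases hij : i = j <;> simp [Matrix.one_apply, hij, S.D_one]
    rw [hQi, h0] at h
    have h2 := congrArg (S.cm Q⁻¹ * ·) h
    simp only [mul_add, mul_zero, ← mul_assoc, hQi', one_mul] at h2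
    exact (neg_eq_of_add_eq_zero_right h2.symm).symm
  have h2 : S.Dm (S.cm Q⁻¹ * T) = S.cm Q⁻¹ * (S.cm K * S.cm Y) := by
    rw [Dm_cm_mul, h1, hT, hQ, hY]
    have : E * S.cm Q * S.cm Q⁻¹ = E := by rw [mul_assoc, hQi, mul_one]
    simp only [mul_sub, sub_mul, neg_sub, ← mul_assoc]
    rw [show S.cm Q⁻¹ * E * S.cm Q * S.cm Q⁻¹ = S.cm Q⁻¹ * E by rw [mul_assoc _ (S.cm Q), hQi, mul_one]]
    abel
  have h3 : S.Dm (S.cm Y) = P * S.cm Q⁻¹ * S.cm K * S.cm Y := by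
    have : S.Dm (S.cm Y) = S.Dm (S.cm R) - S.Dm (P * (S.cm Q⁻¹ * T)) := by
      rw [hY, mul_assoc]; ext i j; simp
    rw [this, Dm_mul, hP, h2, hR, hPQ, ← mul_assoc, hQi]
    simp [mul_assoc]
  have scal : ∀ (M : Matrix (Fin n) (Fin n) S.A0) (X : Matrix (Fin n) (Fin n) A),
      (X * (S.cm M * S.cm M.adjugate)).trace = (M.det : A) * X.trace := by
    intro M X
    rw [← cm_mul, Matrix.mul_adjugate]
    have : S.cm (M.det • (1 : Matrix (Fin n) (Fin n) S.A0)) = (M.det : A) • (1 : Matrix (Fin n) (Fin n) A) := by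
      ext i j
      by_cases hij : i = j <;> simp [Matrix.one_apply, hij]
    rw [this, Matrix.trace, Matrix.trace, Finset.mul_sum]
    refine Finset.sum_congr rfl fun i _ => ?_
    simp [Matrix.mul_apply, Matrix.one_apply]
    exact (S.ev _ _ M.det.2).symm
  have dY : S.D (Y.det : A) = (Y.det : A) * (S.cm K * (P * S.cm Q⁻¹)).trace := by
    rw [D_det, h3, mul_assoc _ (S.cm Y), scal, trace_cm_comm]
  have dQ : S.D (Q.det : A) = (Q.det : A) * ((S.cm K * (P * S.cm Q⁻¹)).trace - E.trace) := by
    have : S.Dm (S.cm Q) = (S.cm K * (P * S.cm Q⁻¹) - E) * S.cm Q := by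
      rw [hQ, sub_mul, mul_assoc, mul_assoc, hQi', mul_one]
    rw [D_det, this, mul_assoc _ (S.cm Q), scal, Matrix.trace_sub]
  have hq' : (Q.det : A) * q = 1 := by exact_mod_cast congrArg (Subtype.val) hq
  have eQ : S.σ (Q.det : A) = Q.det := Q.det.2
  have eY : S.σ (Y.det : A) = Y.det := Y.det.2
  have hqQ : (q : A) * Q.det = 1 := by rw [S.ev _ _ q.2, hq']
  have dq : S.D (q : A) = (q:A) * (E.trace - (S.cm K * (P * S.cm Q⁻¹)).trace) := by
    have h := S.D_mul (Q.det : A) q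
    rw [hq', S.D_one, eQ, dQ] at h
    have h' := congrArg ((q:A) * ·) h
    simp only [mul_add, mul_zero, ← mul_assoc, hqQ, one_mul] at h'
    rw [← S.ev (q:A) _ q.2] at h'
    rw [← neg_eq_of_add_eq_zero_right h'.symm, ← mul_neg, neg_sub, mul_assoc (S.cm K)]
  push_cast
  rw [S.D_mul, eY, dY, dq, mul_assoc (Y.det : A), ← S.ev (q:A) _ q.2]
  noncomm_ring

end SDA
end

noncomputable section
namespace SDA
variable {A : Type} [Ring A] [Algebra ℝ A] (S : SDA A)

lemma sum_range_two_mul {M : Type} [AddCommGroup M] (g : ℕ → M) (k : ℕ) :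
    ∑ i ∈ Finset.range (2*k), g i = ∑ i ∈ Finset.range k, (g (2*i) + g (2*i+1)) := by
  induction k with
  | zero => simp
  | succ k ih =>
    rw [show 2*(k+1) = 2*k+1+1 by ring, Finset.sum_range_succ, Finset.sum_range_succ, Finset.sum_range_succ, ih]
    abel

theorem main_abs {α u : A} (n : ℕ) (θ : ℕ → A) (lam : ℕ → ℝ)
    (hα : S.σ α = -α) (hu : S.σ u = u) (hS : S.Sol α u)
    (hθ : ∀ j < 2*(n+1), S.σ (θ j) = (-1:ℝ)^j • θ j)
    (hL : ∀ j < 2*(n+1), S.Lin α u (lam j) (θ j))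
    (hU : ∀ m < 2*(n+1), IsUnit (S.dI θ m m))
    (R Q Y Yh : Matrix (Fin (n+1)) (Fin (n+1)) S.A0) (P T Rh Ph : Matrix (Fin (n+1)) (Fin (n+1)) A)
    (hR : ∀ i j, (R i j : A) = S.jet (θ (2*j.1)) (2*i.1))
    (hT : ∀ i j, T i j = S.jet (θ (2*j.1)) (2*i.1+1))
    (hP : ∀ i j, P i j = S.jet (θ (2*j.1+1)) (2*i.1))
    (hQ : ∀ i j, (Q i j : A) = S.jet (θ (2*j.1+1)) (2*i.1+1))
    (hRh : ∀ i j, Rh i j = if i.1 = n then S.jet (θ (2*j.1)) (2*(n+1)) else S.jet (θ (2*j.1)) (2*i.1))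
    (hPh : ∀ i j, Ph i j = if i.1 = n then S.jet (θ (2*j.1+1)) (2*(n+1)) else S.jet (θ (2*j.1+1)) (2*i.1))
    (hY : S.cm Y = S.cm R - P * S.cm Q⁻¹ * T)
    (hYh : S.cm Yh = Rh - Ph * S.cm Q⁻¹ * T)
    (q s si sh : S.A0) (hq : Q.det * q = 1) (hs : s = Y.det * q) (hsi : s * si = 1) (hsh : sh = Yh.det * q) :
    S.Sol (α - (2:ℝ) • S.jet (S.D s * si) 2)
      (u + (2:ℝ) • S.jet (sh * si) 2 + (α + (α - (2:ℝ) • S.jet (S.D s * si) 2)) * (S.D s * si)) := by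
  obtain ⟨αn, un, e, ho, he, hSn, -, -, h0, e0, -, eσ, hsum, hαn, hun⟩ :=
    S.chain (2*(n+1)) θ lam hα hu hS hθ hL hU _ le_rfl
  have rel : ∀ j < 2*(n+1), S.jet (θ j) (2*(n+1)) + ∑ l : Fin (n+1), (e (2*(n+1) - 2*l.1) * S.jet (θ j) (2*l.1)
      + e (2*(n+1) - (2*l.1+1)) * S.jet (θ j) (2*l.1+1)) = 0 := by
    intro j hj
    have h := hsum j
    rw [h0 j hj, ← Finset.Nat.sum_antidiagonal_swap,
      Finset.Nat.sum_antidiagonal_eq_sum_range_succ_mk, Finset.sum_range_succ] at h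
    simp only [Prod.swap, sum_range_two_mul, Nat.sub_self, e0, one_mul] at h
    rw [h, Fin.sum_univ_eq_sum_range (fun l => e (2*(n+1) - 2*l) * S.jet (θ j) (2*l)
      + e (2*(n+1) - (2*l+1)) * S.jet (θ j) (2*l+1)), add_comm]
  have ebe : ∀ l : ℕ, S.σ (e (2*(n+1) - 2*l)) = e (2*(n+1) - 2*l) := fun l => by
    rw [eσ, Even.neg_one_pow (by rw [← Nat.mul_sub]; exact even_two_mul _), one_smul]
  let b : Fin (n+1) → S.A0 := fun l => ⟨e (2*(n+1) - 2*l.1), ebe l⟩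
  let E : Matrix (Fin (n+1)) (Fin (n+1)) A := fun i l => if i.1 = n then e (2*(n+1) - (2*l.1+1)) else 0
  let K : Matrix (Fin (n+1)) (Fin (n+1)) S.A0 := fun i l =>
    if i.1 = n then - b l else if l.1 = i.1 + 1 then 1 else 0
  let G : Matrix (Fin (n+1)) (Fin (n+1)) S.A0 := fun i l =>
    if i.1 = n then - b l else if l = i then 1 else 0
  have bcoe : ∀ l, (b l : A) = e (2*(n+1) - 2*l.1) := fun l => rfl
  have last : ∀ j < 2*(n+1), S.jet (θ j) (2*(n+1)) = ∑ l : Fin (n+1), (-(b l:A)) * S.jet (θ j) (2*l.1)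
      - ∑ l : Fin (n+1), e (2*(n+1) - (2*l.1+1)) * S.jet (θ j) (2*l.1+1) := by
    intro j hj
    rw [eq_neg_of_add_eq_zero_left (rel j hj), Finset.sum_add_distrib]
    simp only [bcoe, neg_mul, Finset.sum_neg_distrib]
    abel
  have rowK : ∀ j < 2*(n+1), ∀ i : Fin (n+1), S.jet (θ j) (2*i.1+2) = ∑ l : Fin (n+1), (K i l : A) * S.jet (θ j) (2*l.1)
      - ∑ l : Fin (n+1), E i l * S.jet (θ j) (2*l.1+1) := by
    intro j hj i
    by_cases hi : i.1 = n
    · simp only [K, E, hi, if_true, NegMemClass.coe_neg]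
      exact last j hj
    · have hi' : i.1 + 1 < n + 1 := by have := i.2; omega
      simp only [K, E, hi, if_false, zero_mul, Finset.sum_const_zero, sub_zero]
      rw [Finset.sum_eq_single (⟨i.1+1, hi'⟩ : Fin (n+1))]
      · simp [mul_add]
      · intro l _ hl
        rw [if_neg (fun h => hl (Fin.ext h))]; simp
      · simp
  have rowG : ∀ j < 2*(n+1), ∀ i : Fin (n+1), (if i.1 = n then S.jet (θ j) (2*(n+1)) else S.jet (θ j) (2*i.1))
      = ∑ l : Fin (n+1), (G i l : A) * S.jet (θ j) (2*l.1)
      - ∑ l : Fin (n+1), E i l * S.jet (θ j) (2*l.1+1) := by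
    intro j hj i
    by_cases hi : i.1 = n
    · simp only [G, E, hi, if_true, NegMemClass.coe_neg]
      exact last j hj
    · simp only [G, E, hi, if_false, zero_mul, Finset.sum_const_zero, sub_zero]
      rw [Finset.sum_eq_single i]
      · simp
      · intro l _ hl
        rw [if_neg hl]; simp
      · simp
  have uQ : IsUnit Q.det := IsUnit.of_mul_eq_one _ hq
  have core := S.sdet_core R Q K Y P T E
    (by
      ext i j
      simp only [Matrix.map_apply, Matrix.neg_apply, hP]
      rw [S.σ_jet (hθ _ (by have := j.2; omega)), Odd.neg_one_pow ⟨j.1 + i.1, by ring⟩]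
      simp)
    (by ext i j; simp [hR, hT, D_jet])
    (by ext i j; simp [hP, hQ, D_jet])
    (by
      ext i j
      simp only [Matrix.map_apply, hT, D_jet, Matrix.sub_apply, Matrix.mul_apply, Subring.subtype_apply, hR]
      exact rowK _ (by have := j.2; omega) i)
    (by
      ext i j
      simp only [Matrix.map_apply, hQ, D_jet, Matrix.sub_apply, Matrix.mul_apply, Subring.subtype_apply, hP]
      exact rowK _ (by have := j.2; omega) i)
    uQ hY q hq
  have trE : E.trace = e 1 := by
    rw [Matrix.trace, Finset.sum_eq_single (Fin.last n)]
    · change (if ((Fin.last n : Fin (n+1)).1) = n then e (2*(n+1) - (2*(Fin.last n).1+1)) else 0) = e 1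
      rw [if_pos (Fin.val_last n), Fin.val_last]; congr 1; omega
    · intro i _ hi
      have : i.1 ≠ n := fun h => hi (Fin.ext h)
      change (if i.1 = n then e (2*(n+1) - (2*i.1+1)) else 0) = 0
      rw [if_neg this]
    · simp
  rw [trE, ← hs] at core
  have hssi : (s:A) * si = 1 := by exact_mod_cast congrArg Subtype.val hsi
  have c1 : S.D s * si = e 1 := by
    rw [core, S.ev _ _ s.2, mul_assoc, hssi, mul_one]
  have hRG : Rh = S.cm G * S.cm R - E * T := by
    ext i j
    simp only [Matrix.map_apply, hT, hRh, Matrix.sub_apply, Matrix.mul_apply, Subring.subtype_apply, hR]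
    exact rowG _ (by have := j.2; omega) i
  have hPG : Ph = S.cm G * P - E * S.cm Q := by
    ext i j
    simp only [Matrix.map_apply, hQ, hPh, Matrix.sub_apply, Matrix.mul_apply, Subring.subtype_apply, hP]
    exact rowG _ (by have := j.2; omega) i
  have hQi : S.cm Q * S.cm Q⁻¹ = 1 := by rw [← cm_mul, Matrix.mul_nonsing_inv _ uQ, cm_one]
  have hYG : Yh = G * Y := by
    have : S.cm Yh = S.cm (G * Y) := by
      rw [hYh, cm_mul, hY, hRG, hPG]
      simp only [mul_sub, sub_mul, ← mul_assoc]
      rw [mul_assoc E, hQi, mul_one]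
      abel
    ext i j
    exact congrFun (congrFun this i) j
  have hGY : G * Y = Y.updateRow (Fin.last n) (∑ l, (- b l) • Y l) := by
    have Gp : ∀ l, G (Fin.last n) l = - b l := fun l => if_pos (Fin.val_last n)
    have Gn : ∀ i : Fin (n+1), i ≠ Fin.last n → ∀ l, G i l = if l = i then 1 else 0 :=
      fun i hi l => if_neg (fun h => hi (Fin.ext h))
    ext1 i j
    by_cases hi : i = Fin.last n
    · subst hi
      rw [Matrix.updateRow_self, Matrix.mul_apply]
      rw [show (∑ l, (- b l) • Y l) j = ∑ l, ((- b l) • Y l) j from Finset.sum_apply _ _ _]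
      refine Finset.sum_congr rfl fun l _ => ?_
      rw [Gp]; rfl
    · rw [Matrix.updateRow_ne hi, Matrix.mul_apply, Finset.sum_eq_single i]
      · rw [Gn i hi, if_pos rfl, one_mul]
      · intro l _ hl
        rw [Gn i hi, if_neg hl, zero_mul]
      · simp
  have hdet : Yh.det = - b (Fin.last n) * Y.det := by
    rw [hYG, hGY, Matrix.det_updateRow_sum, smul_eq_mul]
  have c2 : (sh * si : A) = - e 2 := by
    have h1 : sh * si = - b (Fin.last n) := by
      rw [hsh, hdet, mul_assoc, mul_assoc, ← mul_assoc Y.det, ← hs, hsi, mul_one]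
    have h2 := congrArg Subtype.val h1
    have h3 : (b (Fin.last n) : A) = e 2 := by
      rw [bcoe]; congr 1; simp; omega
    rw [← h3]
    exact_mod_cast h2
  have hev : (-1:ℝ)^(2*(n+1)) = 1 := Even.neg_one_pow (even_two_mul _)
  rw [hev] at hαn hun
  rw [c1, c2]
  have a1 : αn = α - (2:ℝ) • S.jet (e 1) 2 := by rw [hαn, one_smul]
  have a2 : un = u + (2:ℝ) • S.jet (-e 2) 2 + (α + (α - (2:ℝ) • S.jet (e 1) 2)) * e 1 := by
    rw [hun, ← a1, jet_neg, one_smul, add_comm αn]; module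
  rw [← a1] at a2 ⊢
  rw [← a2]
  exact hSn

end SDA
end

noncomputable section
namespace SFA
variable {N : ℕ}

instance finSA : Module.Finite ℝ (SuperAlg N) :=
  Module.Finite.of_basis (Pi.basisFun ℝ (Fin N)).ExteriorAlgebra

/-- a basis of the exterior algebra -/
def bs (N : ℕ) : Module.Basis (Fin (Module.finrank ℝ (SuperAlg N))) ℝ (SuperAlg N) :=
  Module.finBasis ℝ (SuperAlg N)

lemma l_eq (l : SuperAlg N →ₗ[ℝ] ℝ) (v : SuperAlg N) :
    l v = ∑ i, (bs N).coord i v * l (bs N i) := by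
  conv_lhs => rw [← (bs N).sum_repr v, map_sum]
  simp

lemma sep {v w : SuperAlg N} (h : ∀ l : SuperAlg N →ₗ[ℝ] ℝ, l v = l w) : v = w :=
  (bs N).ext_elem fun i => h ((bs N).coord i)

lemma bil_eq (B : SuperAlg N →ₗ[ℝ] SuperAlg N →ₗ[ℝ] SuperAlg N) (l : SuperAlg N →ₗ[ℝ] ℝ) (v w : SuperAlg N) :
    l (B v w) = ∑ i, ∑ j, (bs N).coord i v * ((bs N).coord j w * l (B (bs N i) (bs N j))) := by
  have h1 : l (B v w) = (l ∘ₗ B.flip w) v := rfl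
  rw [h1, l_eq]
  refine Finset.sum_congr rfl fun i _ => ?_
  have h2 : (l ∘ₗ B.flip w) (bs N i) = (l ∘ₗ B (bs N i)) w := rfl
  rw [h2, l_eq (l ∘ₗ B (bs N i)) w, Finset.mul_sum]
  rfl

def HD (g : ℝ → SuperAlg N) (d : SuperAlg N) (x : ℝ) : Prop :=
  ∀ l : SuperAlg N →ₗ[ℝ] ℝ, HasDerivAt (fun y => l (g y)) (l d) x

lemma HD.der {g : ℝ → SuperAlg N} {d : SuperAlg N} {x : ℝ} (h : HD g d x) : derLam g x = d := by
  have hex : ∃ d : SuperAlg N, ∀ l : SuperAlg N →ₗ[ℝ] ℝ, HasDerivAt (fun y => l (g y)) (l d) x := ⟨d, h⟩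
  rw [derLam, dif_pos hex]
  exact sep fun l => (hex.choose_spec l).unique (h l)

lemma HD.of {g : ℝ → SuperAlg N} {x : ℝ} (h : ∀ l : SuperAlg N →ₗ[ℝ] ℝ, DifferentiableAt ℝ (fun y => l (g y)) x) :
    HD g (derLam g x) x := by
  have : HD g (∑ i, deriv (fun y => (bs N).coord i (g y)) x • bs N i) x := by
    intro l
    have e : (fun y => l (g y)) = fun y => ∑ i, (bs N).coord i (g y) * l (bs N i) := by
      funext y; exact l_eq l _
    rw [e, map_sum]
    simp only [map_smul, smul_eq_mul]
    exact HasDerivAt.fun_sum fun i _ => (h ((bs N).coord i)).hasDerivAt.mul_const _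
  rw [this.der]; exact this

lemma HD.add {f g : ℝ → SuperAlg N} {d e : SuperAlg N} {x : ℝ} (h : HD f d x) (h' : HD g e x) :
    HD (fun y => f y + g y) (d + e) x := fun l => by
  simp only [map_add]; exact (h l).add (h' l)

lemma HD.lin {f : ℝ → SuperAlg N} {d : SuperAlg N} {x : ℝ} (h : HD f d x) (T : SuperAlg N →ₗ[ℝ] SuperAlg N) :
    HD (fun y => T (f y)) (T d) x := fun l => h (l ∘ₗ T)

lemma HD.bil {f g : ℝ → SuperAlg N} {d e : SuperAlg N} {x : ℝ} (h : HD f d x) (h' : HD g e x)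
    (B : SuperAlg N →ₗ[ℝ] SuperAlg N →ₗ[ℝ] SuperAlg N) :
    HD (fun y => B (f y) (g y)) (B d (g x) + B (f x) e) x := fun l => by
  rw [show (fun y => l (B (f y) (g y))) = fun y => _ from funext fun y => bil_eq B l (f y) (g y),
    map_add, bil_eq B l d, bil_eq B l (f x)]
  simp only [← Finset.sum_add_distrib]
  refine HasDerivAt.fun_sum fun i _ => HasDerivAt.fun_sum fun j _ => ?_
  exact (h ((bs N).coord i)).mul ((h' ((bs N).coord j)).mul_const _)

lemma HD.mul {f g : ℝ → SuperAlg N} {d e : SuperAlg N} {x : ℝ} (h : HD f d x) (h' : HD g e x) :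
    HD (fun y => f y * g y) (d * g x + f x * e) x := h.bil h' (LinearMap.mul ℝ _)

lemma HD.const (c : SuperAlg N) (x : ℝ) : HD (fun _ => c) 0 x := fun l => by
  rw [map_zero]; exact hasDerivAt_const _ _

/-! smoothness -/

abbrev px (g : ℝ → ℝ → SuperAlg N) : ℝ → ℝ → SuperAlg N := fun x t => derLam (fun y => g y t) x
abbrev pt (g : ℝ → ℝ → SuperAlg N) : ℝ → ℝ → SuperAlg N := fun x t => derLam (fun s => g x s) t

lemma sm_iff {g : ℝ → ℝ → SuperAlg N} (h : ∀ i, ContDiff ℝ (⊤ : ℕ∞) (fun p : ℝ × ℝ => (bs N).coord i (g p.1 p.2))) :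
    SmoothLam g := fun l => by
  have e : (fun p : ℝ × ℝ => l (g p.1 p.2)) = fun p => ∑ i, (bs N).coord i (g p.1 p.2) * l (bs N i) := by
    funext y; exact l_eq l _
  rw [e]
  exact ContDiff.sum fun i _ => (h i).mul contDiff_const

lemma sm_add {f g : ℝ → ℝ → SuperAlg N} (hf : SmoothLam f) (hg : SmoothLam g) : SmoothLam (f + g) := fun l => by
  simp only [Pi.add_apply, map_add]; exact (hf l).add (hg l)

lemma sm_lin {f : ℝ → ℝ → SuperAlg N} (hf : SmoothLam f) (T : SuperAlg N →ₗ[ℝ] SuperAlg N) :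
    SmoothLam (fun x t => T (f x t)) := fun l => hf (l ∘ₗ T)

lemma sm_const (c : SuperAlg N) : SmoothLam (fun _ _ => c) := fun l => contDiff_const

lemma sm_x : SmoothLam (fun x _ => x • (1 : SuperAlg N)) := fun l => by
  simp only [map_smul, smul_eq_mul]; exact contDiff_fst.mul contDiff_const

lemma sm_bil {f g : ℝ → ℝ → SuperAlg N} (hf : SmoothLam f) (hg : SmoothLam g)
    (B : SuperAlg N →ₗ[ℝ] SuperAlg N →ₗ[ℝ] SuperAlg N) : SmoothLam (fun x t => B (f x t) (g x t)) := fun l => by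
  rw [show (fun p : ℝ × ℝ => l (B (f p.1 p.2) (g p.1 p.2))) = fun p => _ from funext fun p => bil_eq B l (f p.1 p.2) (g p.1 p.2)]
  exact ContDiff.sum fun i _ => ContDiff.sum fun j _ => (hf _).mul ((hg _).mul contDiff_const)

lemma sm_mul {f g : ℝ → ℝ → SuperAlg N} (hf : SmoothLam f) (hg : SmoothLam g) :
    SmoothLam (fun x t => f x t * g x t) := sm_bil hf hg (LinearMap.mul ℝ _)

lemma sm_hdx {g : ℝ → ℝ → SuperAlg N} (hg : SmoothLam g) (x t : ℝ) : HD (fun y => g y t) (px g x t) x := by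
  refine HD.of fun l => ?_
  have h := (hg l).differentiable (by simp)
  exact (h.comp (g := fun p : ℝ × ℝ => l (g p.1 p.2)) (f := fun y : ℝ => (y, t)) (by fun_prop)) x

lemma sm_hdt {g : ℝ → ℝ → SuperAlg N} (hg : SmoothLam g) (x t : ℝ) : HD (fun s => g x s) (pt g x t) t := by
  refine HD.of fun l => ?_
  have h := (hg l).differentiable (by simp)
  exact (h.comp (g := fun p : ℝ × ℝ => l (g p.1 p.2)) (f := fun y : ℝ => (x, y)) (by fun_prop)) t

lemma l_px {g : ℝ → ℝ → SuperAlg N} (hg : SmoothLam g) (l : SuperAlg N →ₗ[ℝ] ℝ) (x t : ℝ) :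
    l (px g x t) = fderiv ℝ (fun p : ℝ × ℝ => l (g p.1 p.2)) (x, t) (1, 0) := by
  have h := ((hg l).differentiable (by simp) (x, t)).hasFDerivAt
  have h2 : HasDerivAt (fun y : ℝ => (y, t)) ((1 : ℝ), (0 : ℝ)) x := (hasDerivAt_id x).prodMk (hasDerivAt_const x t)
  exact (sm_hdx hg x t l).unique (HasFDerivAt.comp_hasDerivAt (l := fun p : ℝ × ℝ => l (g p.1 p.2)) x h h2)

lemma l_pt {g : ℝ → ℝ → SuperAlg N} (hg : SmoothLam g) (l : SuperAlg N →ₗ[ℝ] ℝ) (x t : ℝ) :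
    l (pt g x t) = fderiv ℝ (fun p : ℝ × ℝ => l (g p.1 p.2)) (x, t) (0, 1) := by
  have h := ((hg l).differentiable (by simp) (x, t)).hasFDerivAt
  have h2 : HasDerivAt (fun y : ℝ => (x, y)) ((0 : ℝ), (1 : ℝ)) t := (hasDerivAt_const t x).prodMk (hasDerivAt_id t)
  exact (sm_hdt hg x t l).unique (HasFDerivAt.comp_hasDerivAt (l := fun p : ℝ × ℝ => l (g p.1 p.2)) t h h2)

lemma cd_fd {h : ℝ × ℝ → ℝ} (hh : ContDiff ℝ (⊤ : ℕ∞) h) (v : ℝ × ℝ) :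
    ContDiff ℝ (⊤ : ℕ∞) (fun p => fderiv ℝ h p v) :=
  (hh.fderiv_right (m := (⊤ : ℕ∞)) (by simp)).clm_apply contDiff_const

lemma sm_px {g : ℝ → ℝ → SuperAlg N} (hg : SmoothLam g) : SmoothLam (px g) := fun l => by
  simp only [l_px hg l]; exact cd_fd (hg l) _

lemma sm_pt {g : ℝ → ℝ → SuperAlg N} (hg : SmoothLam g) : SmoothLam (pt g) := fun l => by
  simp only [l_pt hg l]; exact cd_fd (hg l) _

lemma mixed {h : ℝ × ℝ → ℝ} (hh : ContDiff ℝ (⊤ : ℕ∞) h) (p v w : ℝ × ℝ) :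
    fderiv ℝ (fun p => fderiv ℝ h p v) p w = fderiv ℝ (fun p => fderiv ℝ h p w) p v := by
  have hd : DifferentiableAt ℝ (fderiv ℝ h) p :=
    ((hh.fderiv_right (m := (⊤ : ℕ∞)) (by simp)).differentiable (by simp)) p
  have e : ∀ v w : ℝ × ℝ, fderiv ℝ (fun p => fderiv ℝ h p v) p w = fderiv ℝ (fderiv ℝ h) p w v := by
    intro v w
    rw [fderiv_clm_apply hd (differentiableAt_const v)]
    simp
  rw [e, e]
  have := (hh.contDiffAt (x := p)).isSymmSndFDerivAt (by simp; exact WithTop.coe_le_coe.2 (le_top (a := (2:ℕ∞))))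
  exact this w v

lemma pt_px {g : ℝ → ℝ → SuperAlg N} (hg : SmoothLam g) : pt (px g) = px (pt g) := by
  funext x t
  refine sep fun l => ?_
  rw [l_pt (sm_px hg), l_px (sm_pt hg)]
  simp only [l_px hg l, l_pt hg l]
  exact mixed (hg l) _ _ _

open Classical Matrix in
lemma sm_inv {f : ℝ → ℝ → SuperAlg N} (hf : SmoothLam f) (hu : ∀ x t, IsUnit (f x t)) :
    SmoothLam (fun x t => Ring.inverse (f x t)) := by
  have hdet : ∀ (M : ℝ × ℝ → Matrix (Fin (Module.finrank ℝ (SuperAlg N))) (Fin (Module.finrank ℝ (SuperAlg N))) ℝ),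
      (∀ i j, ContDiff ℝ (⊤ : ℕ∞) fun p => M p i j) → ContDiff ℝ (⊤ : ℕ∞) fun p => (M p).det := by
    intro M hM
    simp only [Matrix.det_apply]
    refine ContDiff.sum fun σ _ => ContDiff.const_smul _ ?_
    exact contDiff_prod fun i _ => hM _ _
  let L := fun p : ℝ × ℝ => Algebra.leftMulMatrix (bs N) (f p.1 p.2)
  have hL : ∀ i j, ContDiff ℝ (⊤ : ℕ∞) fun p => L p i j := by
    intro i j
    simp only [L, Algebra.leftMulMatrix_eq_repr_mul]
    exact (hf ((bs N).coord i ∘ₗ (LinearMap.mul ℝ _).flip (bs N j)))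
  have hun : ∀ p, IsUnit (L p).det := fun p => by
    rw [← Matrix.isUnit_iff_isUnit_det]; exact (hu p.1 p.2).map (Algebra.leftMulMatrix (bs N))
  refine sm_iff fun i => ?_
  have e : (fun p : ℝ × ℝ => (bs N).coord i (Ring.inverse (f p.1 p.2))) =
      fun p => (L p).det⁻¹ * ∑ j, (L p).adjugate i j * (bs N).repr 1 j := by
    funext p
    have h1 : L p *ᵥ (bs N).repr (Ring.inverse (f p.1 p.2)) = (bs N).repr 1 := by
      simp only [L]
      rw [Algebra.leftMulMatrix_mulVec_repr, Ring.mul_inverse_cancel _ (hu _ _)]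
    have h2 := congrArg (fun v => (L p)⁻¹ *ᵥ v) h1
    simp only [Matrix.mulVec_mulVec, Matrix.nonsing_inv_mul _ (hun p), Matrix.one_mulVec] at h2
    have h3 := congrFun h2 i
    rw [Module.Basis.coord_apply, h3, Matrix.inv_def, Matrix.smul_mulVec, Pi.smul_apply, Ring.inverse_eq_inv', smul_eq_mul]
    rfl
  rw [e]
  refine ((hdet L hL).inv fun p => (hun p).ne_zero).mul (ContDiff.sum fun j _ => ContDiff.mul ?_ contDiff_const)
  simp only [Matrix.adjugate_apply]
  refine hdet _ fun a b => ?_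
  by_cases h : a = j
  · subst h; simp only [Matrix.updateRow_self]; exact contDiff_const
  · simp only [Matrix.updateRow_ne h]; exact hL _ _

end SFA
end

noncomputable section
namespace SFA
variable {N : ℕ}

local notation "iv" => CliffordAlgebra.involute (Q := (0 : QuadraticForm ℝ (Fin _ → ℝ)))

lemma iv_iv (x : SuperAlg N) : iv (iv x) = x := CliffordAlgebra.involute_involute x

lemma iota_mul (v : Fin N → ℝ) (x : SuperAlg N) : ExteriorAlgebra.ι ℝ v * x = iv x * ExteriorAlgebra.ι ℝ v := by
  induction x using ExteriorAlgebra.induction with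
  | algebraMap r => rw [AlgHom.commutes, Algebra.commutes]
  | ι w =>
    have h : iv (ExteriorAlgebra.ι ℝ w) = -ExteriorAlgebra.ι ℝ w := CliffordAlgebra.involute_ι w
    rw [h, neg_mul]; exact eq_neg_of_add_eq_zero_left (ExteriorAlgebra.ι_add_mul_swap v w)
  | mul a b ha hb => rw [← mul_assoc, ha, mul_assoc, hb, map_mul, mul_assoc]
  | add a b ha hb => rw [mul_add, ha, hb, map_add, add_mul]

lemma ev_comm {x : SuperAlg N} (hx : iv x = x) (y : SuperAlg N) : x * y = y * x := by
  induction y using ExteriorAlgebra.induction with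
  | algebraMap r => rw [Algebra.commutes]
  | ι w => rw [iota_mul, hx]
  | mul a b ha hb => rw [← mul_assoc, ha, mul_assoc, hb, mul_assoc]
  | add a b ha hb => rw [mul_add, ha, hb, add_mul]

lemma od_comm {x : SuperAlg N} (hx : iv x = -x) (y : SuperAlg N) : x * y = iv y * x := by
  induction y using ExteriorAlgebra.induction with
  | algebraMap r => rw [AlgHom.commutes, Algebra.commutes]
  | ι w =>
    have h : iv (ExteriorAlgebra.ι ℝ w) = -ExteriorAlgebra.ι ℝ w := CliffordAlgebra.involute_ι w
    rw [h, neg_mul, iota_mul, hx, neg_mul, neg_neg]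
  | mul a b ha hb => rw [← mul_assoc, ha, mul_assoc, hb, map_mul, mul_assoc]
  | add a b ha hb => rw [mul_add, ha, hb, map_add, add_mul]

section simps
variable (f g : SF N) (x t : ℝ) (r : ℝ) (n : ℤ)
lemma add0 : (f + g).c0 x t = f.c0 x t + g.c0 x t := rfl
lemma add1 : (f + g).c1 x t = f.c1 x t + g.c1 x t := rfl
lemma mul0 : (f * g).c0 x t = f.c0 x t * g.c0 x t := rfl
lemma mul1 : (f * g).c1 x t = f.c1 x t * g.c0 x t + iv (f.c0 x t) * g.c1 x t := rfl
lemma one0 : (1 : SF N).c0 x t = 1 := rfl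
lemma one1 : (1 : SF N).c1 x t = 0 := rfl
lemma zero0 : (0 : SF N).c0 x t = 0 := rfl
lemma zero1 : (0 : SF N).c1 x t = 0 := rfl
lemma neg0 : (-f).c0 x t = -f.c0 x t := rfl
lemma neg1 : (-f).c1 x t = -f.c1 x t := rfl
lemma smul0 : (r • f).c0 x t = r • f.c0 x t := rfl
lemma smul1 : (r • f).c1 x t = r • f.c1 x t := rfl
end simps

lemma sfext {f g : SF N} (h0 : ∀ x t, f.c0 x t = g.c0 x t) (h1 : ∀ x t, f.c1 x t = g.c1 x t) : f = g :=
  SF.ext (funext fun x => funext fun t => h0 x t) (funext fun x => funext fun t => h1 x t)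

abbrev ringSF (N : ℕ) : Ring (SF N) :=
  { (inferInstance : AddCommGroup (SF N)), (inferInstance : Mul (SF N)), (inferInstance : One (SF N)) with
    left_distrib := fun a b c => by
      apply sfext <;> intro x t
      · simp only [mul0, add0, mul_add]
      · simp only [mul1, add0, add1, mul_add]; abel
    right_distrib := fun a b c => by
      apply sfext <;> intro x t
      · simp only [mul0, add0, add_mul]
      · simp only [mul1, add0, add1, add_mul, map_add]; abel
    zero_mul := fun a => by
      apply sfext <;> intro x t
      · simp only [mul0, zero0, zero_mul]
      · simp only [mul1, zero0, zero1, zero_mul, map_zero, add_zero]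
    mul_zero := fun a => by
      apply sfext <;> intro x t
      · simp only [mul0, zero0, mul_zero]
      · simp only [mul1, zero0, zero1, mul_zero, add_zero]
    mul_assoc := fun a b c => by
      apply sfext <;> intro x t
      · simp only [mul0, mul_assoc]
      · simp only [mul0, mul1, add_mul, mul_add, map_mul, mul_assoc]; abel
    one_mul := fun a => by
      apply sfext <;> intro x t
      · simp only [mul0, one0, one_mul]
      · simp only [mul1, one0, one1, zero_mul, map_one, one_mul, zero_add]
    mul_one := fun a => by
      apply sfext <;> intro x t
      · simp only [mul0, one0, mul_one]
      · simp only [mul1, one0, one1, mul_zero, mul_one, add_zero] }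

attribute [local instance] ringSF

abbrev modSF (N : ℕ) : Module ℝ (SF N) :=
  Function.Injective.module ℝ
    (M := (ℝ → ℝ → SuperAlg N) × (ℝ → ℝ → SuperAlg N))
    { toFun := fun f => (f.c0, f.c1), map_zero' := rfl, map_add' := fun _ _ => rfl }
    (fun a b h => by cases a; cases b; simpa using h) (fun _ _ => rfl)

attribute [local instance] modSF

abbrev algSF (N : ℕ) : Algebra ℝ (SF N) :=
  Algebra.ofModule (fun r a b => by
      apply sfext <;> intro x t
      · simp only [mul0, smul0, smul_mul_assoc]
      · simp only [mul1, smul0, smul1, smul_mul_assoc, map_smul, smul_add])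
    (fun r a b => by
      apply sfext <;> intro x t
      · simp only [mul0, smul0, mul_smul_comm]
      · simp only [mul1, smul0, smul1, mul_smul_comm, smul_add])

attribute [local instance] algSF

lemma s_add {f g : SF N} (hf : f.Smooth) (hg : g.Smooth) : (f + g).Smooth :=
  ⟨sm_add hf.1 hg.1, sm_add hf.2 hg.2⟩

lemma s_mul {f g : SF N} (hf : f.Smooth) (hg : g.Smooth) : (f * g).Smooth :=
  ⟨sm_mul hf.1 hg.1, sm_add (sm_mul hf.2 hg.1) (sm_mul (sm_lin hf.1 (iv).toLinearMap) hg.2)⟩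

lemma s_smul (r : ℝ) {f : SF N} (hf : f.Smooth) : (r • f).Smooth :=
  ⟨sm_lin hf.1 (r • LinearMap.id), sm_lin hf.2 (r • LinearMap.id)⟩

lemma s_one : (1 : SF N).Smooth := ⟨sm_const _, sm_const _⟩

/-- smooth superfields -/
def Sm (N : ℕ) : Subalgebra ℝ (SF N) where
  carrier := {f | f.Smooth}
  mul_mem' := s_mul
  add_mem' := s_add
  algebraMap_mem' := fun r => by
    rw [Set.mem_ofPred_eq, Algebra.algebraMap_eq_smul_one]; exact s_smul r s_one

lemma s_sinv {f : SF N} (hf : f.Smooth) (hi : f.Invertible) : f.sinv.Smooth := by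
  have h1 := sm_inv hf.1 hi
  have h2 := sm_inv (sm_lin hf.1 (iv).toLinearMap) (fun x t => (hi x t).map iv)
  exact ⟨h1, sm_lin (sm_mul (sm_mul h2 hf.2) h1) (-LinearMap.id)⟩

lemma mul_sinv {f : SF N} (hi : f.Invertible) : f * f.sinv = 1 := by
  apply sfext <;> intro x t
  · exact Ring.mul_inverse_cancel _ (hi x t)
  · rw [mul1, one1]
    simp only [SF.sinv]
    rw [mul_neg, ← mul_assoc, ← mul_assoc, Ring.mul_inverse_cancel _ ((hi x t).map iv), one_mul, add_neg_cancel]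

lemma sinv_mul {f : SF N} (hi : f.Invertible) : f.sinv * f = 1 := by
  apply sfext <;> intro x t
  · exact Ring.inverse_mul_cancel _ (hi x t)
  · rw [mul1, one1]
    simp only [SF.sinv]
    have h : iv (Ring.inverse (f.c0 x t)) = Ring.inverse (iv (f.c0 x t)) := by
      obtain ⟨w, hw⟩ := hi x t
      rw [← hw, Ring.inverse_unit]
      exact (Ring.inverse_unit (Units.map ((iv : SuperAlg N →ₐ[ℝ] SuperAlg N) : SuperAlg N →* SuperAlg N) w)).symm
    rw [neg_mul, mul_assoc (_ * _), Ring.inverse_mul_cancel _ (hi x t), mul_one, h, neg_add_cancel]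

def sg (f : SF N) : SF N := ⟨fun x t => iv (f.c0 x t), fun x t => - iv (f.c1 x t)⟩

lemma s_sg {f : SF N} (hf : f.Smooth) : (sg f).Smooth :=
  ⟨sm_lin hf.1 (iv).toLinearMap, sm_lin hf.2 (-(iv).toLinearMap)⟩

lemma s_D {f : SF N} (hf : f.Smooth) : f.Dsd.Smooth := ⟨hf.2, sm_px hf.1⟩
lemma s_dt {f : SF N} (hf : f.Smooth) : f.dt.Smooth := ⟨sm_pt hf.1, sm_pt hf.2⟩

lemma px_add {f g : ℝ → ℝ → SuperAlg N} (hf : SmoothLam f) (hg : SmoothLam g) (x t : ℝ) :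
    px (fun x t => f x t + g x t) x t = px f x t + px g x t := ((sm_hdx hf x t).add (sm_hdx hg x t)).der
lemma pt_add {f g : ℝ → ℝ → SuperAlg N} (hf : SmoothLam f) (hg : SmoothLam g) (x t : ℝ) :
    pt (fun x t => f x t + g x t) x t = pt f x t + pt g x t := ((sm_hdt hf x t).add (sm_hdt hg x t)).der
lemma px_mul {f g : ℝ → ℝ → SuperAlg N} (hf : SmoothLam f) (hg : SmoothLam g) (x t : ℝ) :
    px (fun x t => f x t * g x t) x t = px f x t * g x t + f x t * px g x t :=
  ((sm_hdx hf x t).mul (sm_hdx hg x t)).der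
lemma pt_mul {f g : ℝ → ℝ → SuperAlg N} (hf : SmoothLam f) (hg : SmoothLam g) (x t : ℝ) :
    pt (fun x t => f x t * g x t) x t = pt f x t * g x t + f x t * pt g x t :=
  ((sm_hdt hf x t).mul (sm_hdt hg x t)).der
lemma px_lin {f : ℝ → ℝ → SuperAlg N} (hf : SmoothLam f) (T : SuperAlg N →ₗ[ℝ] SuperAlg N) (x t : ℝ) :
    px (fun x t => T (f x t)) x t = T (px f x t) := ((sm_hdx hf x t).lin T).der
lemma pt_lin {f : ℝ → ℝ → SuperAlg N} (hf : SmoothLam f) (T : SuperAlg N →ₗ[ℝ] SuperAlg N) (x t : ℝ) :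
    pt (fun x t => T (f x t)) x t = T (pt f x t) := ((sm_hdt hf x t).lin T).der

def sgHom (N : ℕ) : Sm N →ₐ[ℝ] Sm N :=
  AlgHom.ofLinearMap
    { toFun := fun f => ⟨sg f.1, s_sg f.2⟩
      map_add' := fun f g => Subtype.ext (by
        apply sfext <;> intro x t
        · exact map_add iv _ _
        · exact (congrArg Neg.neg (map_add iv _ _)).trans (neg_add _ _))
      map_smul' := fun r f => Subtype.ext (by
        apply sfext <;> intro x t
        · exact map_smul iv _ _
        · exact (congrArg Neg.neg (map_smul iv _ _)).trans (smul_neg _ _).symm) }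
    (Subtype.ext (by
        apply sfext <;> intro x t
        · exact map_one iv
        · exact (congrArg Neg.neg (map_zero iv)).trans neg_zero))
    (fun f g => Subtype.ext (by
        apply sfext <;> intro x t
        · exact map_mul iv _ _
        · change - iv (f.1.c1 x t * g.1.c0 x t + iv (f.1.c0 x t) * g.1.c1 x t) =
            (- iv (f.1.c1 x t)) * iv (g.1.c0 x t) + iv (iv (f.1.c0 x t)) * (- iv (g.1.c1 x t))
          simp only [map_add, map_mul, neg_mul, mul_neg, neg_add]))

def Dl (N : ℕ) : Sm N →ₗ[ℝ] Sm N where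
  toFun f := ⟨f.1.Dsd, s_D f.2⟩
  map_add' f g := Subtype.ext (by
    apply sfext <;> intro x t
    · rfl
    · exact px_add f.2.1 g.2.1 x t)
  map_smul' r f := Subtype.ext (by
    apply sfext <;> intro x t
    · rfl
    · exact px_lin f.2.1 (r • LinearMap.id) x t)

def tl (N : ℕ) : Sm N →ₗ[ℝ] Sm N where
  toFun f := ⟨f.1.dt, s_dt f.2⟩
  map_add' f g := Subtype.ext (by
    apply sfext <;> intro x t
    · exact pt_add f.2.1 g.2.1 x t
    · exact pt_add f.2.2 g.2.2 x t)
  map_smul' r f := Subtype.ext (by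
    apply sfext <;> intro x t
    · exact pt_lin f.2.1 (r • LinearMap.id) x t
    · exact pt_lin f.2.2 (r • LinearMap.id) x t)

/-- the superdifferential algebra of smooth superfields -/
def SS (N : ℕ) : SDA (Sm N) where
  σ := sgHom N
  D := Dl N
  τ := tl N
  σσ f := Subtype.ext (by
    apply sfext <;> intro x t
    · exact iv_iv _
    · change - iv (- iv (f.1.c1 x t)) = _
      rw [map_neg, neg_neg, iv_iv])
  D_mul f g := Subtype.ext (by
    apply sfext <;> intro x t
    · rfl
    · change px (fun x t => f.1.c0 x t * g.1.c0 x t) x t =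
        (px f.1.c0 x t * g.1.c0 x t + iv (f.1.c1 x t) * g.1.c1 x t) +
        ((- iv (f.1.c1 x t)) * g.1.c1 x t + iv (iv (f.1.c0 x t)) * px g.1.c0 x t)
      rw [px_mul f.2.1 g.2.1, iv_iv, neg_mul]; abel)
  τ_mul f g := Subtype.ext (by
    apply sfext <;> intro x t
    · exact pt_mul f.2.1 g.2.1 x t
    · change pt (fun x t => f.1.c1 x t * g.1.c0 x t + iv (f.1.c0 x t) * g.1.c1 x t) x t =
        (pt f.1.c1 x t * g.1.c0 x t + iv (pt f.1.c0 x t) * g.1.c1 x t) +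
        (f.1.c1 x t * pt g.1.c0 x t + iv (f.1.c0 x t) * pt g.1.c1 x t)
      have hi := sm_lin f.2.1 (iv).toLinearMap
      have e := pt_lin f.2.1 (iv).toLinearMap x t
      have e2 := pt_mul hi g.2.2 x t
      rw [e] at e2
      refine (pt_add (sm_mul f.2.2 g.2.1) (sm_mul hi g.2.2) x t).trans ?_
      rw [e2, pt_mul f.2.2 g.2.1]
      simp only [AlgHom.toLinearMap_apply]
      abel)
  τD f := Subtype.ext (by
    apply sfext <;> intro x t
    · rfl
    · exact congrFun (congrFun (pt_px f.2.1) x) t)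
  σD f := Subtype.ext (by
    apply sfext <;> intro x t
    · exact (neg_neg _).symm
    · change - iv (px f.1.c0 x t) = - px (fun x t => iv (f.1.c0 x t)) x t
      exact congrArg Neg.neg (px_lin f.2.1 (iv).toLinearMap x t).symm)
  ev f g h := Subtype.ext (by
    have h0 : ∀ x t, iv (f.1.c0 x t) = f.1.c0 x t := fun x t => congrArg (fun F : Sm N => F.1.c0 x t) h
    have h1 : ∀ x t, iv (f.1.c1 x t) = - f.1.c1 x t := fun x t =>
      neg_eq_iff_eq_neg.1 (congrArg (fun F : Sm N => F.1.c1 x t) h)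
    apply sfext <;> intro x t
    · exact ev_comm (h0 x t) _
    · change f.1.c1 x t * g.1.c0 x t + iv (f.1.c0 x t) * g.1.c1 x t =
        g.1.c1 x t * f.1.c0 x t + iv (g.1.c0 x t) * f.1.c1 x t
      rw [h0, ev_comm (h0 x t), od_comm (h1 x t), add_comm])
  od f g h h' := Subtype.ext (by
    have h0 : ∀ x t, iv (f.1.c0 x t) = - f.1.c0 x t := fun x t => congrArg (fun F : Sm N => F.1.c0 x t) h
    have h1 : ∀ x t, iv (f.1.c1 x t) = f.1.c1 x t := fun x t =>
      neg_inj.1 (congrArg (fun F : Sm N => F.1.c1 x t) h)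
    have g0 : ∀ x t, iv (g.1.c0 x t) = - g.1.c0 x t := fun x t => congrArg (fun F : Sm N => F.1.c0 x t) h'
    have g1 : ∀ x t, iv (g.1.c1 x t) = g.1.c1 x t := fun x t =>
      neg_inj.1 (congrArg (fun F : Sm N => F.1.c1 x t) h')
    apply sfext <;> intro x t
    · change f.1.c0 x t * g.1.c0 x t = - (g.1.c0 x t * f.1.c0 x t)
      rw [od_comm (h0 x t), g0, neg_mul]
    · change f.1.c1 x t * g.1.c0 x t + iv (f.1.c0 x t) * g.1.c1 x t =
        -(g.1.c1 x t * f.1.c0 x t + iv (g.1.c0 x t) * f.1.c1 x t)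
      rw [h0, g0, ev_comm (h1 x t), neg_mul, ev_comm (g1 x t), neg_mul]; abel)
  ϑ := ⟨⟨fun _ _ => 0, fun _ _ => 1⟩, sm_const _, sm_const _⟩
  X := ⟨⟨fun x _ => x • (1 : SuperAlg N), fun _ _ => 0⟩, sm_x, sm_const _⟩
  σϑ := Subtype.ext (by
    apply sfext <;> intro x t
    · exact (map_zero iv).trans neg_zero.symm
    · exact congrArg Neg.neg (map_one iv))
  Dϑ := Subtype.ext (by
    apply sfext <;> intro x t
    · rfl
    · exact (HD.const 0 x).der)
  DX := Subtype.ext (by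
    apply sfext <;> intro x t
    · rfl
    · change derLam (fun y : ℝ => y • (1 : SuperAlg N)) x = 1
      refine HD.der fun l => ?_
      simp only [map_smul, smul_eq_mul]
      simpa using (hasDerivAt_id x).mul_const (l 1))

end SFA
end

noncomputable section
namespace SFA
variable {N : ℕ}
attribute [local instance] ringSF modSF algSF

local notation "iv" => CliffordAlgebra.involute (Q := (0 : QuadraticForm ℝ (Fin _ → ℝ)))

lemma Xpow_jet (f : Sm N) (m : ℕ) : Xpow m f.1 = ((SS N).jet f (2*m)).1 := by
  induction m with
  | zero => rfl
  | succ m ih =>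
    rw [Xpow, ih, show 2*(m+1) = 2*m+1+1 by ring, ← SDA.D_jet, ← SDA.D_jet]
    rfl

lemma DXpow_jet (f : Sm N) (m : ℕ) : (Xpow m f.1).Dsd = ((SS N).jet f (2*m+1)).1 := by
  rw [Xpow_jet, ← SDA.D_jet]; rfl

lemma even_σ {f : Sm N} (h : f.1.IsEven) : (SS N).σ f = f := Subtype.ext (by
  apply sfext <;> intro x t
  · exact CliffordAlgebra.involute_eq_of_mem_even (h.1 x t)
  · exact (congrArg Neg.neg (CliffordAlgebra.involute_eq_of_mem_odd (h.2 x t))).trans (neg_neg _))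

lemma odd_σ {f : Sm N} (h : f.1.IsOdd) : (SS N).σ f = -f := Subtype.ext (by
  apply sfext <;> intro x t
  · exact CliffordAlgebra.involute_eq_of_mem_odd (h.1 x t)
  · exact (congrArg Neg.neg (CliffordAlgebra.involute_eq_of_mem_even (h.2 x t))))

lemma par_σ {f : Sm N} {m : ℕ} (h : parityAt f.1 m) : (SS N).σ f = (-1:ℝ)^m • f := by
  unfold parityAt at h
  by_cases hm : m % 2 = 0
  · rw [if_pos hm] at h
    rw [even_σ h, (Nat.even_iff.2 hm).neg_one_pow, one_smul]
  · rw [if_neg hm] at h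
    rw [odd_σ h, (Nat.not_even_iff_odd.1 (fun h => hm (Nat.even_iff.1 h))).neg_one_pow, neg_smul, one_smul]

lemma sol_of {α u : Sm N} (h : MRSKdV α.1 u.1) : (SS N).Sol α u := ⟨Subtype.ext h.1, Subtype.ext h.2⟩
lemma of_sol {α u : Sm N} (h : (SS N).Sol α u) : MRSKdV α.1 u.1 :=
  ⟨congrArg Subtype.val h.1, congrArg Subtype.val h.2⟩

lemma lin_of {α u ψ : Sm N} {l : ℝ} (h : LinSys α.1 u.1 l ψ.1) : (SS N).Lin α u l ψ := by
  set S := SS N with hS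
  have h1 : S.Lo α u ψ = l • ψ := Subtype.ext h.1
  have h2 : S.τ ψ = (1/2 : ℝ) • (α * S.jet ψ 3) + l • S.jet ψ 2 + (1/2 : ℝ) • (u * S.jet ψ 2)
    - (1/4 : ℝ) • (S.jet α 2 * S.jet ψ 1) - (1/4 : ℝ) • (S.jet u 2 * ψ) := Subtype.ext h.2
  refine ⟨h1, ?_⟩
  have h3 : l • S.jet ψ 2 = S.jet ψ 6 + (S.jet α 2 * S.jet ψ 1 + α * S.jet ψ 3) + (S.jet u 2 * ψ + u * S.jet ψ 2) := by
    rw [← SDA.jet_smul, ← h1, SDA.Lo, SDA.jet_add, SDA.jet_add, SDA.jet2_mul, SDA.jet2_mul, SDA.jet_jet, SDA.jet_jet]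
  rw [h2, h3, SDA.Bo]
  module

lemma unit_of {f : Sm N} (h : f.1.Invertible) : IsUnit f :=
  ⟨⟨f, ⟨f.1.sinv, s_sinv f.2 h⟩, Subtype.ext (mul_sinv h), Subtype.ext (sinv_mul h)⟩, rfl⟩

lemma inv_of {f : Sm N} (h : f.1.Invertible) : (Ring.inverse f).1 = f.1.sinv :=
  congrArg Subtype.val (Ring.inverse_unit
    (⟨f, ⟨f.1.sinv, s_sinv f.2 h⟩, Subtype.ext (mul_sinv h), Subtype.ext (sinv_mul h)⟩ : (Sm N)ˣ))

lemma darb (θ : ℕ → SF N) (K : ℕ) (θ' : ℕ → Sm N) (hθ : ∀ j < K, (θ' j).1 = θ j)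
    (hi : ∀ m < K, (darbIter θ m m).Invertible) :
    ∀ m ≤ K, ∀ j < K, ((SS N).dI θ' m j).1 = darbIter θ m j := by
  intro m
  induction m with
  | zero => intro _ j hj; exact hθ j hj
  | succ m ih =>
    intro hm j hj
    have e1 := ih (by omega) m (by omega)
    have e2 := ih (by omega) j hj
    have i1 : ((SS N).dI θ' m m).1.Invertible := by rw [e1]; exact hi m (by omega)
    have e3 := inv_of i1
    change ((SS N).dI θ' m j).1.Dsd + (-(((SS N).dI θ' m m).1.Dsd * (Ring.inverse ((SS N).dI θ' m m)).1)) * ((SS N).dI θ' m j).1 = _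
    rw [e3, e1, e2]
    rfl

abbrev E0 (N : ℕ) := (SS N).A0

/-- coercion to superfields -/
def φ (N : ℕ) : E0 N →+* SF N := ((Sm N).subtype : Sm N →+* SF N).comp (E0 N).subtype

lemma φ_apply (a : E0 N) : φ N a = a.1.1 := rfl

lemma det_φ {k : ℕ} (M : Matrix (Fin k) (Fin k) (E0 N)) : detSF (M.map (φ N)) = φ N M.det := by
  rw [← Matrix.det_transpose, Matrix.det_apply, map_sum]
  refine Finset.sum_congr rfl fun σ _ => ?_
  rw [Units.smul_def, map_zsmul, Fin.prod_univ_def, map_list_prod, List.map_map]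
  rfl

lemma dropIdx_eq {n : ℕ} (j : Fin (n+1)) (i : Fin n) : dropIdx j i = j.succAbove i := by
  apply Fin.ext
  simp only [dropIdx, Fin.succAbove]
  split_ifs with h1 h2 h2
  · rfl
  · exact absurd (by simpa [Fin.lt_def] using h1) h2
  · exact absurd (by simpa [Fin.lt_def] using h2) h1
  · rfl

lemma adj_φ {n : ℕ} (M : Matrix (Fin (n+1)) (Fin (n+1)) (E0 N)) : adjSF (M.map (φ N)) = M.adjugate.map (φ N) := by
  ext1 i j
  rw [Matrix.map_apply, Matrix.adjugate_fin_succ_eq_det_submatrix, map_mul, ← det_φ]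
  have e : minorSF (M.map (φ N)) j i = (M.submatrix j.succAbove i.succAbove).map (φ N) := by
    ext1 a b
    change φ N (M (dropIdx j a) (dropIdx i b)) = φ N (M (j.succAbove a) (i.succAbove b))
    rw [dropIdx_eq, dropIdx_eq]
  change ((-1 : ℤ) ^ (i.1 + j.1)) • detSF (minorSF (M.map (φ N)) j i) = _
  rw [e, map_pow, map_neg, map_one, add_comm]
  refine (zsmul_eq_mul _ _).trans ?_
  push_cast
  rfl

lemma lift_inv (f : E0 N) (h : (φ N f).Invertible) : ∃ q : E0 N, f * q = 1 ∧ φ N q = (φ N f).sinv := by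
  let g : Sm N := ⟨f.1.1.sinv, s_sinv f.1.2 h⟩
  have h1 : f.1 * g = 1 := Subtype.ext (mul_sinv h)
  have h2 : g * f.1 = 1 := Subtype.ext (sinv_mul h)
  have hg : (SS N).σ g = g := by
    have h3 : f.1 * (SS N).σ g = 1 := by
      have := congrArg (SS N).σ h1
      rw [map_mul, map_one] at this
      rwa [show (SS N).σ f.1 = f.1 from f.2] at this
    calc (SS N).σ g = g * f.1 * (SS N).σ g := by rw [h2, one_mul]
      _ = g := by rw [mul_assoc, h3, mul_one]
  exact ⟨⟨g, hg⟩, Subtype.ext h1, rfl⟩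

lemma inv_φ {n : ℕ} (M : Matrix (Fin (n+1)) (Fin (n+1)) (E0 N)) (q : E0 N) (h : M.det * q = 1)
    (hq : φ N q = (φ N M.det).sinv) : invSF (M.map (φ N)) = M⁻¹.map (φ N) := by
  have e : M⁻¹ = q • M.adjugate := by
    apply Matrix.inv_eq_right_inv
    rw [Matrix.mul_smul, Matrix.mul_adjugate, smul_smul, mul_comm, h, one_smul]
  rw [e]
  ext1 i j
  change (detSF (M.map (φ N))).sinv * adjSF (M.map (φ N)) i j = φ N (q * M.adjugate i j)
  rw [map_mul, hq, adj_φ, det_φ]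
  rfl

end SFA
end

noncomputable section
namespace SFA
variable {N : ℕ}
attribute [local instance] ringSF modSF algSF

/-- inclusion of smooth superfields -/
def vl (N : ℕ) : Sm N →+* SF N := ((Sm N).subtype : Sm N →+* SF N)

lemma schur_lift {n : ℕ} (Rm P T : Matrix (Fin n) (Fin n) (Sm N)) (Qi : Matrix (Fin n) (Fin n) (E0 N))
    (hR : ∀ i j, (SS N).σ (Rm i j) = Rm i j) (hP : ∀ i j, (SS N).σ (P i j) = - P i j)
    (hT : ∀ i j, (SS N).σ (T i j) = - T i j) :
    ∃ Y : Matrix (Fin n) (Fin n) (E0 N), (SS N).cm Y = Rm - P * (SS N).cm Qi * T := by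
  refine ⟨fun i j => ⟨(Rm - P * (SS N).cm Qi * T) i j, ?_⟩, ?_⟩
  · change (SS N).σ _ = _
    have hq : ∀ i j, (SS N).σ (Qi i j).1 = (Qi i j).1 := fun i j => (Qi i j).2
    simp only [Matrix.sub_apply, Matrix.mul_apply, Matrix.map_apply, map_sub, map_sum, map_mul, hR, hP, hT,
      Subring.subtype_apply, hq, neg_mul, mul_neg, Finset.sum_neg_distrib, neg_neg]
  · ext1 i j; rfl

lemma vl_schur {n : ℕ} (Rm P T : Matrix (Fin n) (Fin n) (Sm N)) (Qi Y : Matrix (Fin n) (Fin n) (E0 N))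
    (h : (SS N).cm Y = Rm - P * (SS N).cm Qi * T) :
    Y.map (φ N) = Rm.map (vl N) - P.map (vl N) * Qi.map (φ N) * T.map (vl N) := by
  have h1 : Y.map (φ N) = ((SS N).cm Y).map (vl N) := rfl
  have h2 : Qi.map (φ N) = ((SS N).cm Qi).map (vl N) := rfl
  rw [h1, h2, h, Matrix.map_sub (vl N) (map_sub (vl N)), Matrix.map_mul, Matrix.map_mul]

theorem final (n : ℕ)
    (α u : SF N) (hαo : α.IsOdd) (hue : u.IsEven) (hαs : α.Smooth) (hus : u.Smooth)
    (hMR : MRSKdV α u)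
    (θ : ℕ → SF N) (lam : ℕ → ℝ)
    (hθs : ∀ j < 2*(n+1), (θ j).Smooth)
    (hθp : ∀ j < 2*(n+1), parityAt (θ j) j)
    (hθl : ∀ j < 2*(n+1), LinSys α u (lam j) (θ j))
    (hdarb : ∀ m < 2*(n+1), (darbIter θ m m).Invertible)
    (h1i : (detSF (DmatSF (W1E N (n+1) θ))).Invertible)
    (h3i : (sdetE N (n+1) θ).Invertible) :
    MRSKdV
      (α - (2:ℝ) • ((sdetE N (n+1) θ).Dsd * (sdetE N (n+1) θ).sinv).dx)
      (u + (2:ℝ) • (sdetEHat N (n+1) θ * (sdetE N (n+1) θ).sinv).dx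
        + (α + (α - (2:ℝ) • ((sdetE N (n+1) θ).Dsd * (sdetE N (n+1) θ).sinv).dx))
          * ((sdetE N (n+1) θ).Dsd * (sdetE N (n+1) θ).sinv)) := by
  classical
  let α' : Sm N := ⟨α, hαs⟩
  let u' : Sm N := ⟨u, hus⟩
  let θ' : ℕ → Sm N := fun j => if h : j < 2*(n+1) then ⟨θ j, hθs j h⟩ else 0
  have hθ' : ∀ j < 2*(n+1), (θ' j).1 = θ j := fun j hj => by simp only [θ', dif_pos hj]
  have hσ : ∀ j < 2*(n+1), (SS N).σ (θ' j) = (-1:ℝ)^j • θ' j := fun j hj =>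
    par_σ (by rw [hθ' j hj]; exact hθp j hj)
  have hL : ∀ j < 2*(n+1), (SS N).Lin α' u' (lam j) (θ' j) := fun j hj =>
    lin_of (by rw [hθ' j hj]; exact hθl j hj)
  have hD := darb θ (2*(n+1)) θ' hθ' hdarb
  have hU : ∀ m < 2*(n+1), IsUnit ((SS N).dI θ' m m) := fun m hm =>
    unit_of (by rw [hD m hm.le m hm]; exact hdarb m hm)
  have je : ∀ j : Fin (n+1), ∀ i, (SS N).σ ((SS N).jet (θ' (2*j.1)) (2*i)) = (SS N).jet (θ' (2*j.1)) (2*i) := by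
    intro j i
    rw [SDA.σ_jet _ (hσ _ (by have := j.2; omega)), Even.neg_one_pow ⟨j.1 + i, by ring⟩, one_smul]
  have jo : ∀ j : Fin (n+1), ∀ i, (SS N).σ ((SS N).jet (θ' (2*j.1)) (2*i+1)) = - (SS N).jet (θ' (2*j.1)) (2*i+1) := by
    intro j i
    rw [SDA.σ_jet _ (hσ _ (by have := j.2; omega)), Odd.neg_one_pow ⟨j.1 + i, by ring⟩, neg_smul, one_smul]
  have oe : ∀ j : Fin (n+1), ∀ i, (SS N).σ ((SS N).jet (θ' (2*j.1+1)) (2*i)) = - (SS N).jet (θ' (2*j.1+1)) (2*i) := by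
    intro j i
    rw [SDA.σ_jet _ (hσ _ (by have := j.2; omega)), Odd.neg_one_pow ⟨j.1 + i, by ring⟩, neg_smul, one_smul]
  have oo : ∀ j : Fin (n+1), ∀ i, (SS N).σ ((SS N).jet (θ' (2*j.1+1)) (2*i+1)) = (SS N).jet (θ' (2*j.1+1)) (2*i+1) := by
    intro j i
    rw [SDA.σ_jet _ (hσ _ (by have := j.2; omega)), Even.neg_one_pow ⟨j.1 + i + 1, by ring⟩, one_smul]
  let R : Matrix (Fin (n+1)) (Fin (n+1)) (E0 N) := fun i j => ⟨_, je j i.1⟩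
  let Q : Matrix (Fin (n+1)) (Fin (n+1)) (E0 N) := fun i j => ⟨_, oo j i.1⟩
  let P : Matrix (Fin (n+1)) (Fin (n+1)) (Sm N) := fun i j => (SS N).jet (θ' (2*j.1+1)) (2*i.1)
  let T : Matrix (Fin (n+1)) (Fin (n+1)) (Sm N) := fun i j => (SS N).jet (θ' (2*j.1)) (2*i.1+1)
  let Rh : Matrix (Fin (n+1)) (Fin (n+1)) (Sm N) := fun i j =>
    if i.1 = n then (SS N).jet (θ' (2*j.1)) (2*(n+1)) else (SS N).jet (θ' (2*j.1)) (2*i.1)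
  let Ph : Matrix (Fin (n+1)) (Fin (n+1)) (Sm N) := fun i j =>
    if i.1 = n then (SS N).jet (θ' (2*j.1+1)) (2*(n+1)) else (SS N).jet (θ' (2*j.1+1)) (2*i.1)
  have cR : W0E N (n+1) θ = ((SS N).cm R).map (vl N) := by
    ext1 i j
    change Xpow i.1 (θ (2*j.1)) = ((SS N).jet (θ' (2*j.1)) (2*i.1)).1
    rw [← Xpow_jet, hθ' _ (by have := j.2; omega)]
  have cP : W1E N (n+1) θ = P.map (vl N) := by
    ext1 i j
    change Xpow i.1 (θ (2*j.1+1)) = ((SS N).jet (θ' (2*j.1+1)) (2*i.1)).1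
    rw [← Xpow_jet, hθ' _ (by have := j.2; omega)]
  have cT : DmatSF (W0E N (n+1) θ) = T.map (vl N) := by
    ext1 i j
    change (Xpow i.1 (θ (2*j.1))).Dsd = ((SS N).jet (θ' (2*j.1)) (2*i.1+1)).1
    rw [← DXpow_jet, hθ' _ (by have := j.2; omega)]
  have cQ : DmatSF (W1E N (n+1) θ) = Q.map (φ N) := by
    ext1 i j
    change (Xpow i.1 (θ (2*j.1+1))).Dsd = ((SS N).jet (θ' (2*j.1+1)) (2*i.1+1)).1
    rw [← DXpow_jet, hθ' _ (by have := j.2; omega)]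
  have cRh : WmatHat N (n+1) (evenSeq θ) = Rh.map (vl N) := by
    ext1 i j
    change (if i.1 = n then Xpow (n+1) (θ (2*j.1)) else Xpow i.1 (θ (2*j.1))) =
      (if i.1 = n then (SS N).jet (θ' (2*j.1)) (2*(n+1)) else (SS N).jet (θ' (2*j.1)) (2*i.1)).1
    rw [← hθ' _ (by have := j.2; omega)]
    split_ifs <;> exact Xpow_jet _ _
  have cPh : WmatHat N (n+1) (oddSeq θ) = Ph.map (vl N) := by
    ext1 i j
    change (if i.1 = n then Xpow (n+1) (θ (2*j.1+1)) else Xpow i.1 (θ (2*j.1+1))) =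
      (if i.1 = n then (SS N).jet (θ' (2*j.1+1)) (2*(n+1)) else (SS N).jet (θ' (2*j.1+1)) (2*i.1)).1
    rw [← hθ' _ (by have := j.2; omega)]
    split_ifs <;> exact Xpow_jet _ _
  obtain ⟨Y, hY⟩ := schur_lift ((SS N).cm R) P T Q⁻¹ (fun i j => (R i j).2) (fun i j => oe j i.1) (fun i j => jo j i.1)
  obtain ⟨Yh, hYh⟩ := schur_lift Rh Ph T Q⁻¹
    (fun i j => by
      change (SS N).σ (if i.1 = n then (SS N).jet (θ' (2*j.1)) (2*(n+1)) else (SS N).jet (θ' (2*j.1)) (2*i.1)) =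
        (if i.1 = n then (SS N).jet (θ' (2*j.1)) (2*(n+1)) else (SS N).jet (θ' (2*j.1)) (2*i.1))
      split_ifs <;> exact je _ _)
    (fun i j => by
      change (SS N).σ (if i.1 = n then (SS N).jet (θ' (2*j.1+1)) (2*(n+1)) else (SS N).jet (θ' (2*j.1+1)) (2*i.1)) =
        -(if i.1 = n then (SS N).jet (θ' (2*j.1+1)) (2*(n+1)) else (SS N).jet (θ' (2*j.1+1)) (2*i.1))
      split_ifs <;> exact oe _ _) (fun i j => jo j i.1)
  have h1i' : (φ N Q.det).Invertible := by rw [← det_φ, ← cQ]; exact h1i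
  obtain ⟨q, hq, hqφ⟩ := lift_inv Q.det h1i'
  have cQi : invSF (DmatSF (W1E N (n+1) θ)) = Q⁻¹.map (φ N) := by
    rw [cQ]; exact inv_φ Q q hq hqφ
  have cS : SchurE N (n+1) θ = Y.map (φ N) := by
    rw [vl_schur _ _ _ _ _ hY, ← cR, ← cP, ← cT, ← cQi]
    rfl
  have cSh : SchurEHat N (n+1) θ = Yh.map (φ N) := by
    rw [vl_schur _ _ _ _ _ hYh, ← cRh, ← cPh, ← cT, ← cQi]
    rfl
  have es : sdetE N (n+1) θ = φ N (Y.det * q) := by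
    rw [map_mul, hqφ, ← det_φ, ← det_φ, ← cS, ← cQ]
    rfl
  have esh : sdetEHat N (n+1) θ = φ N (Yh.det * q) := by
    rw [map_mul, hqφ, ← det_φ, ← det_φ, ← cSh, ← cQ]
    rfl
  rw [es] at h3i
  obtain ⟨si, hsi, hsiφ⟩ := lift_inv (Y.det * q) h3i
  rw [es, esh, ← hsiφ]
  exact of_sol (SDA.main_abs (SS N) (α := α') (u := u') n θ' lam (odd_σ hαo) (even_σ hue) (sol_of hMR) hσ hL hU
    R Q Y Yh P T Rh Ph (fun _ _ => rfl) (fun _ _ => rfl) (fun _ _ => rfl) (fun _ _ => rfl) (fun _ _ => rfl)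
    (fun _ _ => rfl) hY hYh q _ si _ hq rfl hsi rfl)

end SFA
end

/-- Wronskian superdeterminant representation of the `2k`-fold
iterated Darboux transformation: the pair
`α̂ = α − 2∂((D sdet 𝒲)(sdet 𝒲)⁻¹)`,
`û = u + 2∂((sdet 𝒲̂)(sdet 𝒲)⁻¹) + (α + α̂)(D sdet 𝒲)(sdet 𝒲)⁻¹`
again solves MRSKdV. -/
theorem statement_11 {N : ℕ} (hN : 1 ≤ N) (k : ℕ) (hk : 1 ≤ k)
    (α u : SF N) (hαo : α.IsOdd) (hue : u.IsEven) (hαs : α.Smooth) (hus : u.Smooth)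
    (hMR : MRSKdV α u)
    (θ : ℕ → SF N) (lam : ℕ → ℝ)
    (hθs : ∀ j < 2*k, (θ j).Smooth)
    (hθp : ∀ j < 2*k, parityAt (θ j) j)
    (hθl : ∀ j < 2*k, LinSys α u (lam j) (θ j))
    (hdarb : ∀ m < 2*k, (darbIter θ m m).Invertible)
    (h1e : (detSF (DmatSF (W1E N k θ))).IsEven)
    (h1i : (detSF (DmatSF (W1E N k θ))).Invertible)
    (h2e : (detSF (SchurE N k θ)).IsEven)
    (h2i : (detSF (SchurE N k θ)).Invertible)
    (h3e : (sdetE N k θ).IsEven)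
    (h3i : (sdetE N k θ).Invertible) :
    MRSKdV
      (α - (2:ℝ) • ((sdetE N k θ).Dsd * (sdetE N k θ).sinv).dx)
      (u + (2:ℝ) • (sdetEHat N k θ * (sdetE N k θ).sinv).dx
        + (α + (α - (2:ℝ) • ((sdetE N k θ).Dsd * (sdetE N k θ).sinv).dx))
          * ((sdetE N k θ).Dsd * (sdetE N k θ).sinv)) := by
  obtain ⟨n, rfl⟩ : ∃ n, k = n + 1 := ⟨k - 1, by omega⟩
  exact SFA.final n α u hαo hue hαs hus hMR θ lam hθs hθp hθl hdarb h1i h3i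
end
end
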